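/- arXiv:2412.13945 — 4 statements merged into one kernel-verified Lean document; each statement's English description precedes it below -/
import Mathlib

section
/- For all sufficiently large n, every properly edge-colored graph G on n vertices with at least 2n·log₂(n) edges contains a cycle of length at most 2·log₂(n) that has an edge of unique color, i.e., an edge whose color is different from the colors of all the other edges of that cycle. -/
namespace SimpleGraph

variable {V C : Type*} {G : SimpleGraph V} {c : Sym2 V → C}

/-- A walk whose colors are pairwise distinct splits around its unique edge of a given color. -/
theorem Walk.exists_split_of_mem_colors {u v : V} (w : G.Walk u v) {x : C}
    (hnd : (w.edges.map c).Nodup) (hx : x ∈ w.edges.map c) :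
    ∃ (a b : V) (p : G.Walk u a) (_ : G.Adj a b) (q : G.Walk b v), c s(a, b) = x ∧
      x ∉ p.edges.map c ∧ x ∉ q.edges.map c ∧ p.length + q.length + 1 = w.length := by
  induction w with
  | nil => simp at hx
  | @cons u u' v h w ih =>
    rw [Walk.edges_cons, List.map_cons, List.nodup_cons] at hnd
    by_cases hc : c s(u, u') = x
    · exact ⟨u, u', .nil, h, w, hc, by simp, hc ▸ hnd.1, by simp⟩
    · rw [Walk.edges_cons, List.map_cons, List.mem_cons] at hx
      obtain ⟨a, b, p, hab, q, h1, h2, h3, h4⟩ := ih hnd.2 (hx.resolve_left (Ne.symm hc))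
      refine ⟨a, b, .cons h p, hab, q, h1, ?_, h3, by simp only [Walk.length_cons]; omega⟩
      rw [Walk.edges_cons, List.map_cons, List.mem_cons]
      exact not_or.2 ⟨Ne.symm hc, h2⟩

/-- Two walks with the same ends, the first with pairwise distinct colors, one of which is absent
from the second, produce a cycle with an edge of unique color. -/
theorem Walk.exists_isCycle_unique_color {u v : V} (w₁ w₂ : G.Walk u v) {x : C}
    (hnd : (w₁.edges.map c).Nodup) (hx₁ : x ∈ w₁.edges.map c) (hx₂ : x ∉ w₂.edges.map c) :
    ∃ (a : V) (w : G.Walk a a), w.IsCycle ∧ w.length ≤ w₁.length + w₂.length ∧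
      ∃ e ∈ w.edges, ∀ f ∈ w.edges, f ≠ e → c f ≠ c e := by
  classical
  obtain ⟨a, b, p, hab, q, hc, hp, hq, hlen⟩ := w₁.exists_split_of_mem_colors hnd hx₁
  set r := q.append (w₂.reverse.append p) with hr
  have hrx : ∀ f ∈ r.bypass.edges, c f ≠ x := by
    intro f hf hfx
    have hf := r.edges_bypass_subset_edges hf
    simp only [hr, Walk.edges_append, Walk.edges_reverse, List.mem_append, List.mem_reverse] at hf
    rcases hf with hf | hf | hf
    · exact hq (hfx ▸ List.mem_map_of_mem hf)
    · exact hx₂ (hfx ▸ List.mem_map_of_mem hf)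
    · exact hp (hfx ▸ List.mem_map_of_mem hf)
  have hrl : r.length = q.length + (w₂.length + p.length) := by simp [hr]
  refine ⟨a, .cons hab r.bypass, ?_, ?_, s(a, b), by simp, ?_⟩
  · exact (Walk.cons_isCycle_iff _ _).2 ⟨r.bypass_isPath, fun h => hrx _ h hc⟩
  · have := r.length_bypass_le_length
    rw [Walk.length_cons]
    omega
  · intro f hf hne
    rw [Walk.edges_cons, List.mem_cons] at hf
    rw [hc]
    exact hrx f (hf.resolve_left hne)

/-- A finite graph with at least `m` times as many edges as vertices has a nonempty set of vertices
inducing a subgraph of minimum degree at least `m`. -/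
theorem exists_nonempty_forall_le_card_neighbors [Fintype V] [DecidableEq V] [DecidableRel G.Adj]
    {m : ℕ} (T : Finset V) (hT : T.Nonempty)
    (hE : m * T.card ≤ (G.edgeFinset.filter (· ∈ T.sym2)).card) :
    ∃ S : Finset V, S.Nonempty ∧ ∀ v ∈ S, m ≤ (S.filter (G.Adj v)).card := by
  induction T using Finset.strongInduction with
  | H T ih =>
    by_contra! hcon
    obtain ⟨v, hv, hdeg⟩ := hcon T hT
    have hsub : G.edgeFinset.filter (· ∈ T.sym2) ⊆
        G.edgeFinset.filter (· ∈ (T.erase v).sym2) ∪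
          (T.filter (G.Adj v)).image (fun u => s(v, u)) := by
      intro e
      induction e with | _ a b
      simp only [Finset.mem_filter, mem_edgeFinset, mem_edgeSet, Finset.mk_mem_sym2_iff,
        Finset.mem_union, Finset.mem_erase, Finset.mem_image, Sym2.eq_iff]
      rintro ⟨hab, ha, hb⟩
      by_cases hav : a = v
      · subst hav
        exact .inr ⟨b, ⟨hb, hab⟩, .inl ⟨rfl, rfl⟩⟩
      by_cases hbv : b = v
      · subst hbv
        exact .inr ⟨a, ⟨ha, hab.symm⟩, .inr ⟨rfl, rfl⟩⟩
      exact .inl ⟨hab, ⟨hav, ha⟩, hbv, hb⟩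
    have hcard := (Finset.card_le_card hsub).trans (Finset.card_union_le _ _)
    have himg := Finset.card_image_le (s := T.filter (G.Adj v)) (f := fun u => s(v, u))
    have hTv := Finset.card_erase_add_one hv
    have hle : m * (T.erase v).card < (G.edgeFinset.filter (· ∈ (T.erase v).sym2)).card := by
      rw [← hTv, mul_add] at hE
      omega
    have hne : (T.erase v).Nonempty := by
      rw [Finset.nonempty_iff_ne_empty]
      intro h0
      simp [h0] at hle
    obtain ⟨S, hS, hS'⟩ := ih _ (Finset.erase_ssubset hv) hne hle.le
    obtain ⟨u, hu, hu'⟩ := hcon S hS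
    exact absurd (hS' u hu) (not_le.2 hu')

section Rainbow

variable [Fintype V] [DecidableEq C]

open Classical in
/-- The pairs `(u, A)` with `u ∈ S` such that `A` is the set of colors of a walk of length `k` with
pairwise distinct colors from `u` to `v`. -/
noncomputable def rainbowEnds (G : SimpleGraph V) (c : Sym2 V → C) (S : Finset V) (v : V) (k : ℕ) :
    Finset (V × Finset C) :=
  (S ×ˢ (Finset.univ.image c).powerset).filter fun p =>
    p.2.card = k ∧ ∃ w : G.Walk p.1 v, w.length = k ∧ (w.edges.map c).toFinset = p.2

theorem mem_rainbowEnds {S : Finset V} {v : V} {k : ℕ} {p : V × Finset C} :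
    p ∈ rainbowEnds G c S v k ↔ p.1 ∈ S ∧ p.2.card = k ∧
      ∃ w : G.Walk p.1 v, w.length = k ∧ (w.edges.map c).toFinset = p.2 := by
  simp only [rainbowEnds, Finset.mem_filter, Finset.mem_product, Finset.mem_powerset]
  refine ⟨fun h => ⟨h.1.1, h.2⟩, fun h => ⟨⟨h.1, ?_⟩, h.2⟩⟩
  obtain ⟨w, -, hw⟩ := h.2.2
  rw [← hw]
  intro x
  simp only [List.mem_toFinset, List.mem_map, Finset.mem_image, Finset.mem_univ, true_and]
  rintro ⟨e, -, he⟩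
  exact ⟨e, he⟩

theorem card_rainbowEnds_mul_le [DecidableRel G.Adj]
    (hc : ∀ a b b' : V, G.Adj a b → G.Adj a b' → b ≠ b' → c s(a, b) ≠ c s(a, b'))
    {S : Finset V} {d : ℕ} (hS : ∀ u ∈ S, d ≤ (S.filter (G.Adj u)).card) (v : V) (k : ℕ) :
    (rainbowEnds G c S v k).card * (d - k) ≤ (rainbowEnds G c S v (k + 1)).card * (k + 1) := by
  classical
  refine Finset.card_mul_le_card_mul
    (fun p q => G.Adj p.1 q.1 ∧ c s(p.1, q.1) ∉ p.2 ∧ q.2 = insert (c s(p.1, q.1)) p.2) ?_ ?_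
  · rintro ⟨u, A⟩ hp
    obtain ⟨hu, hA, w, hw, hwA⟩ := mem_rainbowEnds.1 hp
    dsimp only at hu hA w hw hwA
    have hinj : Set.InjOn (fun b => c s(u, b)) (S.filter (G.Adj u)) := by
      intro b hb b' hb' h
      by_contra hne
      exact hc u b b' (Finset.mem_filter.1 hb).2 (Finset.mem_filter.1 hb').2 hne h
    have hbad : ((S.filter (G.Adj u)).filter (fun b => c s(u, b) ∈ A)).card ≤ k := by
      rw [← hA]
      refine Finset.card_le_card_of_injOn (fun b => c s(u, b)) ?_ ?_
      · intro b hb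
        exact (Finset.mem_filter.1 hb).2
      · exact hinj.mono fun b hb => (Finset.mem_filter.1 hb).1
    have hsplit := Finset.card_filter_add_card_filter_not (s := S.filter (G.Adj u))
      (fun b => c s(u, b) ∈ A)
    have hgood : d - k ≤ ((S.filter (G.Adj u)).filter (fun b => c s(u, b) ∉ A)).card := by
      have := hS u hu
      omega
    refine hgood.trans (Finset.card_le_card_of_injOn (fun b => (b, insert (c s(u, b)) A)) ?_ ?_)
    · intro b hb
      simp only [Finset.coe_filter, Finset.mem_filter, Set.mem_ofPred_eq] at hb
      obtain ⟨⟨hbS, hub⟩, hbA⟩ := hb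
      refine Finset.mem_coe.2 ((Finset.mem_bipartiteAbove _).2 ⟨mem_rainbowEnds.2 ⟨hbS, ?_, ?_⟩,
        hub, hbA, rfl⟩)
      · simp [Finset.card_insert_of_notMem hbA, hA]
      · exact ⟨.cons hub.symm w, by simp [hw], by simp [← hwA, Sym2.eq_swap]⟩
    · intro b _ b' _ h
      exact (Prod.ext_iff.1 h).1
  · rintro ⟨u, B⟩ hq
    obtain ⟨-, hB, -⟩ := mem_rainbowEnds.1 hq
    rw [← hB]
    refine Finset.card_le_card_of_injOn (fun p => c s(p.1, u)) ?_ ?_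
    · intro p hp
      obtain ⟨-, -, -, h⟩ := (Finset.mem_bipartiteBelow _).1 (Finset.mem_coe.1 hp)
      dsimp only at h ⊢
      rw [h]
      exact Finset.mem_insert_self _ _
    · rintro ⟨a, A⟩ hp ⟨a', A'⟩ hp' h
      obtain ⟨-, had, hA, hBA⟩ := (Finset.mem_bipartiteBelow _).1 (Finset.mem_coe.1 hp)
      obtain ⟨-, had', hA', hBA'⟩ := (Finset.mem_bipartiteBelow _).1 (Finset.mem_coe.1 hp')
      dsimp only at h had hA hBA had' hA' hBA'
      have haa : a = a' := by
        by_contra hne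
        refine hc u a a' had.symm had'.symm hne ?_
        rwa [Sym2.eq_swap, Sym2.eq_swap (a := u)]
      subst haa
      rw [Prod.mk.injEq]
      refine ⟨rfl, ?_⟩
      rw [← Finset.erase_insert hA, ← Finset.erase_insert hA', ← hBA, ← hBA']

theorem choose_le_card_rainbowEnds [DecidableRel G.Adj]
    (hc : ∀ a b b' : V, G.Adj a b → G.Adj a b' → b ≠ b' → c s(a, b) ≠ c s(a, b'))
    {S : Finset V} {d : ℕ} (hS : ∀ u ∈ S, d ≤ (S.filter (G.Adj u)).card) {v : V} (hv : v ∈ S)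
    (k : ℕ) : d.choose k ≤ (rainbowEnds G c S v k).card := by
  induction k with
  | zero =>
    rw [Nat.choose_zero_right, Nat.one_le_iff_ne_zero, Finset.card_ne_zero]
    exact ⟨(v, ∅), mem_rainbowEnds.2 ⟨hv, rfl, .nil, rfl, rfl⟩⟩
  | succ k ih =>
    refine Nat.le_of_mul_le_mul_right ?_ k.succ_pos
    rw [Nat.succ_eq_add_one, Nat.choose_succ_right_eq]
    exact (Nat.mul_le_mul_right _ ih).trans (card_rainbowEnds_mul_le hc hS v k)

/-- If no short cycle has an edge of unique color, a vertex determines the colors of the rainbow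
walks leaving it. -/
theorem card_rainbowEnds_le {S : Finset V} {v : V} {k : ℕ}
    (hno : ∀ (a : V) (w : G.Walk a a), w.IsCycle → w.length ≤ k + k →
      ¬ ∃ e ∈ w.edges, ∀ f ∈ w.edges, f ≠ e → c f ≠ c e) :
    (rainbowEnds G c S v k).card ≤ Fintype.card V := by
  refine Finset.card_le_card_of_injOn Prod.fst (t := Finset.univ) (by simp) ?_
  rintro ⟨u, A⟩ hp ⟨u', B⟩ hq h
  obtain ⟨-, hA, w₁, hw₁, hwA⟩ := mem_rainbowEnds.1 (Finset.mem_coe.1 hp)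
  obtain ⟨-, hB, w₂, hw₂, hwB⟩ := mem_rainbowEnds.1 (Finset.mem_coe.1 hq)
  dsimp only at h hA w₁ hw₁ hwA hB w₂ hw₂ hwB
  subst h
  rw [Prod.mk.injEq]
  refine ⟨rfl, Finset.eq_of_subset_of_card_le (fun x hx => ?_) (hB.trans hA.symm).le⟩
  by_contra hxB
  have hnd : (w₁.edges.map c).Nodup := by
    rw [← Multiset.coe_nodup, ← Multiset.toFinset_card_eq_card_iff_nodup]
    simp only [← List.toFinset_coe] at hwA
    rw [hwA, hA]
    simp [hw₁]
  obtain ⟨a, w, hcyc, hlen, he⟩ := w₁.exists_isCycle_unique_color w₂ hnd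
    (List.mem_toFinset.1 (hwA.symm ▸ hx)) (fun h => hxB (hwB ▸ List.mem_toFinset.2 h))
  exact hno a w hcyc (by omega) he

end Rainbow

end SimpleGraph

theorem Nat.lt_centralBinom_log_two {n : ℕ} (hn : 16 ≤ n) :
    n < (Nat.log 2 n).centralBinom := by
  set k := Nat.log 2 n
  have hk : 4 ≤ k := Nat.le_log_of_pow_le one_lt_two hn
  have hlt : n < 2 ^ (k + 1) := Nat.lt_pow_succ_log_self one_lt_two n
  have hpow : 4 * k ≤ 2 ^ k := by
    clear_value k
    clear hlt
    induction k, hk using Nat.le_induction with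
    | base => norm_num
    | succ k hk ih => rw [pow_succ]; omega
  have hcb := Nat.four_pow_le_two_mul_self_mul_centralBinom k (by omega)
  have h4 : 4 ^ k = 2 ^ k * 2 ^ k := by rw [← mul_pow]; rfl
  by_contra! hle
  rw [pow_succ] at hlt
  nlinarith [Nat.mul_le_mul_left (2 * k) hle, Nat.mul_le_mul_left (2 ^ k) hpow]


/-- For all sufficiently large `n`, every properly edge-colored graph `G` on `n`
vertices with at least `2 n log₂ n` edges contains a cycle of length at most `2 log₂ n`
having an edge of unique color. -/
theorem cycle_with_unique_color_edge :
    ∃ n₀ : ℕ, ∀ n : ℕ, n₀ ≤ n →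
      ∀ (G : SimpleGraph (Fin n)) (c : Sym2 (Fin n) → ℕ),
        (∀ a b b' : Fin n, G.Adj a b → G.Adj a b' → b ≠ b' → c s(a, b) ≠ c s(a, b')) →
        2 * (n : ℝ) * Real.logb 2 n ≤ (G.edgeSet.ncard : ℝ) →
        ∃ (v : Fin n) (w : G.Walk v v), w.IsCycle ∧
          (w.length : ℝ) ≤ 2 * Real.logb 2 n ∧
          ∃ e ∈ w.edges, ∀ f ∈ w.edges, f ≠ e → c f ≠ c e := by
  classical
  refine ⟨16, fun n hn G c hc hE => ?_⟩
  by_contra hcon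
  have hk : (Nat.log 2 n : ℝ) ≤ Real.logb 2 n := by
    simpa using Real.natLog_le_logb n 2
  have hkpos : 0 < Nat.log 2 n := Nat.log_pos one_lt_two (by omega)
  have hedges : 2 * Nat.log 2 n * n ≤ G.edgeFinset.card := by
    rw [← Set.ncard_coe_finset, SimpleGraph.coe_edgeFinset]
    have : (2 * Nat.log 2 n * n : ℝ) ≤ 2 * (n : ℝ) * Real.logb 2 n := by
      nlinarith [mul_le_mul_of_nonneg_left hk (Nat.cast_nonneg (α := ℝ) n)]
    exact_mod_cast this.trans hE
  have : Nonempty (Fin n) := ⟨⟨0, by omega⟩⟩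
  obtain ⟨S, ⟨v, hv⟩, hS⟩ := G.exists_nonempty_forall_le_card_neighbors
    (m := 2 * Nat.log 2 n) Finset.univ Finset.univ_nonempty (by simpa using hedges)
  have hlow := SimpleGraph.choose_le_card_rainbowEnds hc hS hv (Nat.log 2 n)
  have hup : (SimpleGraph.rainbowEnds G c S v (Nat.log 2 n)).card ≤ Fintype.card (Fin n) := by
    refine SimpleGraph.card_rainbowEnds_le fun a w hcyc hlen he => hcon ⟨a, w, hcyc, ?_, he⟩
    have : (w.length : ℝ) ≤ Nat.log 2 n + Nat.log 2 n := by exact_mod_cast hlen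
    linarith
  rw [Fintype.card_fin] at hup
  exact absurd (hlow.trans hup) (not_le.2 (Nat.lt_centralBinom_log_two hn))
end

section
/- For every even integer k ≥ 2 there exist constants C > 0 and D > 0 such that the following holds for all sufficiently large n and every integer ℓ with k/2 ≤ ℓ ≤ n: every k-uniform hypergraph on n vertices with at least C·n·(n/ℓ)^{k/2 − 1}·log₂(n) hyperedges contains a nonempty collection of at most D·ℓ·log₂(n) distinct hyperedges that covers every vertex an even number of times. -/
section WalkSum

open Finset

variable {M : Type*} [AddCommGroup M]

lemma add_self_of_zmod_two [Module (ZMod 2) M] (x : M) : x + x = 0 := by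
  have h : (2 : ZMod 2) • x = 0 := by
    rw [show (2 : ZMod 2) = 0 from rfl, zero_smul]
  rwa [two_smul] at h

lemma exists_sum_eq_zero_of_finrank_lt [Module (ZMod 2) M] [Module.Finite (ZMod 2) M]
    {E : Finset M} (hE : Module.finrank (ZMod 2) M < #E) :
    ∃ F ⊆ E, F.Nonempty ∧ #F ≤ Module.finrank (ZMod 2) M + 1 ∧ ∑ e ∈ F, e = 0 := by
  obtain ⟨t, htE, ht⟩ := exists_subset_card_eq (Nat.succ_le_of_lt hE)
  obtain ⟨f, hf, x, hx, hfx⟩ := Module.exists_nontrivial_relation_of_finrank_lt_card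
    (R := ZMod 2) (t := t) (by omega)
  refine ⟨{e ∈ t | f e ≠ 0}, (filter_subset _ _).trans htE, ⟨x, mem_filter.2 ⟨hx, hfx⟩⟩,
    (card_filter_le _ _).trans ht.le, ?_⟩
  rw [← hf, sum_filter]
  refine sum_congr rfl fun e _ => ?_
  have : ∀ a : ZMod 2, a ≠ 0 → a = 1 := by decide
  split_ifs with h
  · rw [this _ h, one_smul]
  · rw [not_not.1 h, zero_smul]

variable [DecidableEq M]

/-- The neighbours of `S` in the Cayley graph with connection set `E`, restricted to `H`. -/
def nbhd (E H : Finset M) (S : M) : Finset M := {T ∈ H | S + T ∈ E}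

/-- The averaging operator of the simple random walk on `H` with connection set `E`. -/
noncomputable def walkOp (E H : Finset M) (f : M → ℝ) (S : M) : ℝ :=
  (∑ T ∈ nbhd E H S, f T) / (#(nbhd E H S) : ℝ)

/-- The expectation of `g labels endpoint` after `t` further steps of the simple random walk
from `S`, where `labels` lists the edge labels used, starting with the list `l`. -/
noncomputable def walkSum (E H : Finset M) (g : List M → M → ℝ) : ℕ → List M → M → ℝ
  | 0, l, S => g l S
  | t + 1, l, S =>
    (∑ T ∈ nbhd E H S, walkSum E H g t ((S + T) :: l) T) / (#(nbhd E H S) : ℝ)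

lemma walkSum_eq_iterate_walkOp (E H : Finset M) (f : M → ℝ) (t : ℕ) (l : List M) (S : M) :
    walkSum E H (fun _ => f) t l S = (walkOp E H)^[t] f S := by
  induction t generalizing l S with
  | zero => rfl
  | succ t ih => simp only [walkSum, ih, Function.iterate_succ_apply', walkOp]

/-- Walks revisiting few labels are rare: an exponential moment bound for the number of distinct
labels. -/
lemma walkSum_pow_card_le {E H : Finset M} {y : ℝ} (hy : 0 ≤ y) {m : ℕ}
    (hdeg : ∀ S ∈ H, 0 < #(nbhd E H S) ∧ (m : ℝ) ≤ y * #(nbhd E H S))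
    {t : ℕ} {l : List M} {S : M} (hS : S ∈ H) (hlen : l.length + t ≤ m) :
    walkSum E H (fun l _ => y ^ #l.toFinset) t l S ≤ (2 * y) ^ t * y ^ #l.toFinset := by
  induction t generalizing l S with
  | zero => simp [walkSum]
  | succ t ih =>
    obtain ⟨hpos, hle⟩ := hdeg S hS
    simp only [walkSum]
    rw [div_le_iff₀ (by exact_mod_cast hpos)]
    have hstep : ∀ T ∈ nbhd E H S, walkSum E H (fun l _ => y ^ #l.toFinset) t ((S + T) :: l) T ≤
        (2 * y) ^ t * y ^ #l.toFinset * (y + if S + T ∈ l then 1 else 0) := by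
      intro T hT
      refine (ih (mem_filter.1 hT).1 (by rw [List.length_cons]; omega)).trans ?_
      rw [mul_assoc]
      gcongr
      rw [List.toFinset_cons]
      split_ifs with hmem
      · rw [insert_eq_of_mem (by simpa using hmem)]
        nlinarith [pow_nonneg hy #l.toFinset]
      · rw [card_insert_of_notMem (by simpa using hmem), pow_succ, add_zero]
    refine (sum_le_sum hstep).trans ?_
    rw [← mul_sum, sum_add_distrib, sum_const, nsmul_eq_mul, sum_boole]
    have hold : #{T ∈ nbhd E H S | S + T ∈ l} ≤ m := by
      calc #{T ∈ nbhd E H S | S + T ∈ l} ≤ #l.toFinset :=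
            card_le_card_of_injOn (S + ·) (fun T hT => by simpa using (mem_filter.1 hT).2)
              (fun _ _ _ _ h => add_left_cancel h)
        _ ≤ l.length := l.toFinset_card_le
        _ ≤ m := by omega
    have hold' : (#{T ∈ nbhd E H S | S + T ∈ l} : ℝ) ≤ m := by exact_mod_cast hold
    rw [pow_succ]
    calc (2 * y) ^ t * y ^ #l.toFinset *
          (#(nbhd E H S) * y + #{T ∈ nbhd E H S | S + T ∈ l})
        ≤ (2 * y) ^ t * y ^ #l.toFinset * (2 * y * #(nbhd E H S)) := by
          gcongr
          linarith
      _ = (2 * y) ^ t * (2 * y) * y ^ #l.toFinset * #(nbhd E H S) := by ring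

lemma sum_card_mul_walkOp_mul {E H : Finset M} (hdeg : ∀ S ∈ H, 0 < #(nbhd E H S))
    (f g : M → ℝ) :
    ∑ S ∈ H, #(nbhd E H S) * (walkOp E H f S * g S) =
      ∑ S ∈ H, #(nbhd E H S) * (f S * walkOp E H g S) := by
  have key : ∀ f g : M → ℝ, ∑ S ∈ H, #(nbhd E H S) * (walkOp E H f S * g S) =
      ∑ S ∈ H, ∑ T ∈ H, if S + T ∈ E then f T * g S else 0 := by
    intro f g
    refine sum_congr rfl fun S hS => ?_
    have : (#(nbhd E H S) : ℝ) ≠ 0 := by exact_mod_cast (hdeg S hS).ne'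
    rw [walkOp, ← sum_filter, ← mul_assoc, mul_div_cancel₀ _ this, sum_mul]
    rfl
  rw [key, sum_comm]
  simp_rw [mul_comm (f _) (walkOp E H g _)]
  rw [key]
  simp_rw [add_comm, mul_comm]

lemma sum_card_mul_iterate_walkOp_mul {E H : Finset M} (hdeg : ∀ S ∈ H, 0 < #(nbhd E H S))
    (r : ℕ) (f g : M → ℝ) :
    ∑ S ∈ H, #(nbhd E H S) * ((walkOp E H)^[r] f S * g S) =
      ∑ S ∈ H, #(nbhd E H S) * (f S * (walkOp E H)^[r] g S) := by
  induction r generalizing f g with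
  | zero => rfl
  | succ r ih =>
    rw [Function.iterate_succ_apply', Function.iterate_succ_apply,
      sum_card_mul_walkOp_mul hdeg, ih]

lemma iterate_walkOp_one {E H : Finset M} (hdeg : ∀ S ∈ H, 0 < #(nbhd E H S)) (r : ℕ) {S : M}
    (hS : S ∈ H) : (walkOp E H)^[r] 1 S = 1 := by
  induction r generalizing S with
  | zero => rfl
  | succ r ih =>
    have : (#(nbhd E H S) : ℝ) ≠ 0 := by exact_mod_cast (hdeg S hS).ne'
    rw [Function.iterate_succ_apply', walkOp, div_eq_one_iff_eq this]
    calc ∑ T ∈ nbhd E H S, (walkOp E H)^[r] 1 T = ∑ T ∈ nbhd E H S, (1 : ℝ) :=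
          sum_congr rfl fun T hT => ih (mem_filter.1 hT).1
      _ = #(nbhd E H S) := by simp

/-- The expected number of fixed points of an even power of the random walk is at least `1`. -/
lemma one_le_sum_iterate_walkOp {E H : Finset M} (hH : H.Nonempty)
    (hdeg : ∀ S ∈ H, 0 < #(nbhd E H S)) (r : ℕ) :
    1 ≤ ∑ S ∈ H, (walkOp E H)^[2 * r] (fun T => if T = S then 1 else 0) S := by
  have hpos : ∀ S ∈ H, (0 : ℝ) < #(nbhd E H S) := fun S hS => by exact_mod_cast hdeg S hS
  have htot : 0 < ∑ S ∈ H, (#(nbhd E H S) : ℝ) := sum_pos hpos hH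
  have hterm : ∀ S ∈ H, (#(nbhd E H S) : ℝ) / ∑ T ∈ H, (#(nbhd E H T) : ℝ) ≤
      (walkOp E H)^[2 * r] (fun T => if T = S then 1 else 0) S := by
    intro S hS
    set δ : M → ℝ := fun T => if T = S then 1 else 0
    have hδ : ∀ f : M → ℝ, ∑ T ∈ H, #(nbhd E H T) * (δ T * f T) = #(nbhd E H S) * f S := by
      intro f
      rw [sum_eq_single_of_mem S hS]
      · simp [δ]
      · intro T _ hT
        simp [δ, hT]
    have h1 : ∑ T ∈ H, #(nbhd E H T) * (walkOp E H)^[r] δ T = (#(nbhd E H S) : ℝ) := by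
      have := sum_card_mul_iterate_walkOp_mul hdeg r δ 1
      rw [hδ, iterate_walkOp_one hdeg r hS] at this
      simpa using this
    have h2 : ∑ T ∈ H, #(nbhd E H T) * ((walkOp E H)^[r] δ T * (walkOp E H)^[r] δ T) =
        #(nbhd E H S) * (walkOp E H)^[2 * r] δ S := by
      rw [sum_card_mul_iterate_walkOp_mul hdeg, hδ, two_mul, Function.iterate_add_apply]
    have h3 := sq_sum_div_le_sum_sq_div H
      (fun T => #(nbhd E H T) * (walkOp E H)^[r] δ T) hpos
    have h4 : ∑ T ∈ H, (#(nbhd E H T) * (walkOp E H)^[r] δ T) ^ 2 / (#(nbhd E H T) : ℝ) =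
        ∑ T ∈ H, #(nbhd E H T) * ((walkOp E H)^[r] δ T * (walkOp E H)^[r] δ T) := by
      refine sum_congr rfl fun T hT => ?_
      have := (hpos T hT).ne'
      field_simp
    rw [h4, h2, h1] at h3
    have := hpos S hS
    refine le_of_mul_le_mul_left (h3.trans' (le_of_eq ?_)) this
    ring
  calc (1 : ℝ) = ∑ S ∈ H, (#(nbhd E H S) : ℝ) / ∑ T ∈ H, (#(nbhd E H T) : ℝ) := by
        rw [← sum_div, div_self htot.ne']
    _ ≤ _ := sum_le_sum hterm

/-- Every graph of average degree at least `2 * a` has an induced subgraph of minimum degree at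
least `a`. -/
lemma exists_minDegree_subset (E : Finset M) {a : ℕ} {V : Finset M} (hV : V.Nonempty)
    (hsum : 2 * a * #V ≤ ∑ S ∈ V, #(nbhd E V S)) :
    ∃ H ⊆ V, H.Nonempty ∧ ∀ S ∈ H, a ≤ #(nbhd E H S) := by
  induction V using Finset.strongInduction with
  | H V ih =>
    by_cases hmin : ∀ S ∈ V, a ≤ #(nbhd E V S)
    · exact ⟨V, Subset.rfl, hV, hmin⟩
    push Not at hmin
    obtain ⟨S, hS, hlt⟩ := hmin
    have hloss : ∀ T ∈ V.erase S, #(nbhd E V T) =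
        #(nbhd E (V.erase S) T) + if S + T ∈ E then 1 else 0 := by
      intro T hT
      simp only [nbhd]
      rw [filter_erase, card_erase_eq_ite, add_comm S T]
      split_ifs with h1 h2 h2
      · have : 0 < #{x ∈ V | T + x ∈ E} := card_pos.2 ⟨S, h1⟩
        omega
      · exact absurd (mem_filter.1 h1).2 h2
      · exact absurd (mem_filter.2 ⟨hS, h2⟩) h1
      · rfl
    have hcount : ∑ T ∈ V.erase S, (if S + T ∈ E then 1 else 0) ≤ #(nbhd E V S) := by
      rw [← card_filter]
      exact card_le_card (filter_subset_filter _ (erase_subset _ _))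
    have hsplit := add_sum_erase V (fun T => #(nbhd E V T)) hS
    rw [sum_congr rfl hloss, sum_add_distrib] at hsplit
    have hcard := card_erase_add_one hS
    have hlarge : 2 * a * #(V.erase S) < ∑ T ∈ V.erase S, #(nbhd E (V.erase S) T) := by
      rw [← hcard] at hsum
      have : 2 * a * (#(V.erase S) + 1) = 2 * a * #(V.erase S) + 2 * a := by ring
      omega
    have hne : (V.erase S).Nonempty := by
      by_contra h
      rw [not_nonempty_iff_eq_empty.1 h] at hlarge
      simp at hlarge
    obtain ⟨H, hHV, hH⟩ := ih _ (erase_ssubset hS) hne hlarge.le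
    exact ⟨H, hHV.trans (erase_subset _ _), hH⟩

variable [Module (ZMod 2) M]

lemma walkSum_mono {E H : Finset M} {g g' : List M → M → ℝ} {t : ℕ} {l : List M} {S : M}
    (hl : ∀ e ∈ l, e ∈ E)
    (h : ∀ l' T, l'.length = l.length + t → T + l'.sum = S + l.sum → (∀ e ∈ l', e ∈ E) →
      g l' T ≤ g' l' T) :
    walkSum E H g t l S ≤ walkSum E H g' t l S := by
  induction t generalizing l S with
  | zero => exact h l S rfl rfl hl
  | succ t ih =>
    simp only [walkSum]
    gcongr with T hT
    refine ih ?_ ?_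
    · simp only [List.mem_cons, forall_eq_or_imp]
      exact ⟨(mem_filter.1 hT).2, hl⟩
    · intro l' U hlen hsum hmem
      refine h l' U (by rw [hlen, List.length_cons]; ring) ?_ hmem
      rw [hsum, List.sum_cons]
      calc T + (S + T + l.sum) = S + l.sum + (T + T) := by abel
        _ = S + l.sum := by rw [add_self_of_zmod_two, add_zero]

/-- A list summing to zero whose entries satisfy no short linear relation uses each of its entries
an even number of times, hence at least twice. -/
lemma two_mul_card_toFinset_le_length {E : Finset M} {l : List M} (hl : ∀ e ∈ l, e ∈ E)
    (hsum : l.sum = 0)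
    (hE : ∀ F ⊆ E, F.Nonempty → #F ≤ l.length → ∑ e ∈ F, e ≠ 0) :
    2 * #l.toFinset ≤ l.length := by
  set F : Finset M := {e ∈ l.toFinset | Odd (l.count e)}
  have hF : ∑ e ∈ F, e = 0 := by
    rw [← hsum, sum_list_count, sum_filter]
    refine sum_congr rfl fun e _ => ?_
    split_ifs with hodd
    · obtain ⟨c, hc⟩ := hodd
      rw [hc, add_smul, mul_comm, mul_smul, two_smul, add_self_of_zmod_two, smul_zero, zero_add,
        one_smul]
    · obtain ⟨c, hc⟩ := Nat.not_odd_iff_even.1 hodd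
      rw [hc, add_smul, add_self_of_zmod_two]
  have hempty : F = ∅ := by
    by_contra hne
    refine hE F (fun e he => hl e (by simpa using (mem_filter.1 he).1))
      (nonempty_iff_ne_empty.2 hne) ?_ hF
    exact (card_filter_le _ _).trans l.toFinset_card_le
  calc 2 * #l.toFinset = ∑ e ∈ l.toFinset, 2 := by rw [sum_const, smul_eq_mul, mul_comm]
    _ ≤ ∑ e ∈ l.toFinset, l.count e := by
      refine sum_le_sum fun e he => ?_
      have hpos : 0 < l.count e := List.count_pos_iff.2 (by simpa using he)
      have heven : ¬ Odd (l.count e) := fun h => by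
        have : e ∈ F := mem_filter.2 ⟨he, h⟩
        simp [hempty] at this
      obtain ⟨c, hc⟩ := Nat.not_odd_iff_even.1 heven
      omega
    _ = l.length := List.sum_toFinset_count_eq_length l

/-- A small induced subgraph of large minimum degree in the Cayley graph of `E` forces a short
linear relation in `E`. -/
theorem exists_sum_eq_zero_of_minDegree {E H : Finset M} (hH : H.Nonempty) {r : ℕ} (hr : 0 < r)
    (hcard : #H < 2 ^ r) (hdeg : ∀ S ∈ H, 16 * r ≤ #(nbhd E H S)) :
    ∃ F ⊆ E, F.Nonempty ∧ #F ≤ 2 * r ∧ ∑ e ∈ F, e = 0 := by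
  by_contra! hE
  have hpos : ∀ S ∈ H, 0 < #(nbhd E H S) := fun S hS => by have := hdeg S hS; omega
  have hterm : ∀ S ∈ H, (walkOp E H)^[2 * r] (fun T => if T = S then 1 else 0) S ≤
      (1 / 2 : ℝ) ^ r := by
    intro S hS
    rw [← walkSum_eq_iterate_walkOp E H _ _ []]
    have hmono : walkSum E H (fun _ T => if T = S then 1 else 0) (2 * r) [] S ≤
        walkSum E H (fun l _ => 8 ^ r * (1 / 8 : ℝ) ^ #l.toFinset) (2 * r) [] S := by
      refine walkSum_mono (by simp) fun l T hlen hsum hl => ?_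
      split_ifs with hT
      · have hl0 : l.sum = 0 := by simpa [hT] using hsum
        have hlen' : l.length = 2 * r := by simpa using hlen
        have hc := two_mul_card_toFinset_le_length hl hl0
          fun F hF hne hle => hE F hF hne (hlen' ▸ hle)
        calc (1 : ℝ) = 8 ^ r * (1 / 8) ^ r := by rw [← mul_pow]; norm_num
          _ ≤ 8 ^ r * (1 / 8) ^ #l.toFinset := by
            gcongr ?_ * ?_
            exact pow_le_pow_of_le_one (by norm_num) (by norm_num) (by omega)
      · positivity
    have hsmul : ∀ t l S, walkSum E H (fun l _ => 8 ^ r * (1 / 8 : ℝ) ^ #l.toFinset) t l S =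
        8 ^ r * walkSum E H (fun l _ => (1 / 8 : ℝ) ^ #l.toFinset) t l S := by
      intro t
      induction t with
      | zero => intro l S; rfl
      | succ t ih => intro l S; simp only [walkSum, ih, ← mul_sum, mul_div_assoc]
    have hbound := walkSum_pow_card_le (E := E) (H := H) (y := 1 / 8) (by norm_num) (m := 2 * r)
      (fun S hS => ⟨hpos S hS, by
        have : (16 * r : ℝ) ≤ #(nbhd E H S) := by exact_mod_cast hdeg S hS
        push_cast
        linarith⟩) (t := 2 * r) (l := []) hS (by simp)
    calc _ ≤ _ := hmono
      _ = _ := hsmul _ _ _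
      _ ≤ 8 ^ r * ((2 * (1 / 8)) ^ (2 * r) * (1 / 8 : ℝ) ^ #([] : List M).toFinset) := by gcongr
      _ = (1 / 2 : ℝ) ^ r := by
        rw [pow_mul, List.toFinset_nil, card_empty, pow_zero, mul_one, ← mul_pow]
        norm_num
  have h1 := (one_le_sum_iterate_walkOp hH hpos r).trans (sum_le_sum hterm)
  rw [sum_const, nsmul_eq_mul, one_div, inv_pow, ← div_eq_mul_inv, one_le_div (by positivity)] at h1
  exact absurd hcard (not_lt.2 (by exact_mod_cast h1))

end WalkSum

section Slice

open Finset

variable {α : Type*} [DecidableEq α]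

/-- The characteristic vector of a finite set over the field with two elements. -/
def charVec (s : Finset α) : α → ZMod 2 := fun v => if v ∈ s then 1 else 0

lemma charVec_injective : Function.Injective (charVec (α := α)) := by
  intro s t h
  ext v
  have := congrFun h v
  by_cases hs : v ∈ s <;> by_cases ht : v ∈ t <;> simp_all [charVec]

lemma charVec_add (s t : Finset α) : charVec s + charVec t = charVec (symmDiff s t) := by
  ext v
  by_cases hs : v ∈ s <;> by_cases ht : v ∈ t <;>
    simp [charVec, mem_symmDiff, hs, ht, CharTwo.add_self_eq_zero]

lemma even_card_filter_mem_of_sum_charVec {F : Finset (Finset α)}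
    (hF : ∑ e ∈ F, charVec e = 0) (v : α) : Even #{e ∈ F | v ∈ e} := by
  have h := congrFun hF v
  simp only [charVec, Finset.sum_apply, sum_boole, Pi.zero_apply] at h
  exact (ZMod.natCast_eq_zero_iff_even).1 h

/-- The characteristic vectors of the `ℓ`-element sets. -/
def charVecSlice (α : Type*) [Fintype α] [DecidableEq α] (ℓ : ℕ) : Finset (α → ZMod 2) :=
  (powersetCard ℓ univ).image charVec

variable [Fintype α]

lemma card_charVecSlice (ℓ : ℕ) : #(charVecSlice α ℓ) = (Fintype.card α).choose ℓ := by
  rw [charVecSlice, card_image_of_injective _ charVec_injective, card_powersetCard, card_univ]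

/-- Each edge of size `2 * h` contributes at least `(n - 2 * h).choose (ℓ - h)` pairs of adjacent
`ℓ`-sets. -/
lemma card_mul_choose_le_sum_nbhd {H : Finset (Finset α)} {h ℓ : ℕ} (hℓ : h ≤ ℓ)
    (hH : ∀ e ∈ H, #e = 2 * h) :
    #H * (Fintype.card α - 2 * h).choose (ℓ - h) ≤
      ∑ S ∈ charVecSlice α ℓ, #(nbhd (H.image charVec) (charVecSlice α ℓ) S) := by
  have hhalf : ∀ e : Finset α, ∃ A ⊆ e, e ∈ H → #A = h := by
    intro e
    by_cases he : e ∈ H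
    · obtain ⟨A, hA, hc⟩ := exists_subset_card_eq (s := e) (n := h) (by rw [hH e he]; omega)
      exact ⟨A, hA, fun _ => hc⟩
    · exact ⟨∅, empty_subset _, fun h => absurd h he⟩
  choose A hAe hA using hhalf
  have hcard : #(H.sigma fun e => powersetCard (ℓ - h) eᶜ) =
      #H * (Fintype.card α - 2 * h).choose (ℓ - h) := by
    rw [card_sigma, ← smul_eq_mul, ← sum_const]
    exact sum_congr rfl fun e he => by rw [card_powersetCard, card_compl, hH e he]
  have hdiff : ∀ (e B : Finset α), B ⊆ eᶜ → symmDiff (A e ∪ B) (e \ A e ∪ B) = e := by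
    intro e B hB
    ext v
    have h1 : v ∈ A e → v ∈ e := fun h => hAe e h
    have h2 : v ∈ B → v ∉ e := fun h => mem_compl.1 (hB h)
    simp only [mem_symmDiff, mem_union, mem_sdiff]
    tauto
  have hmem : ∀ s : Finset α, #s = ℓ → charVec s ∈ charVecSlice α ℓ := fun s hs =>
    mem_image_of_mem _ (mem_powersetCard.2 ⟨subset_univ _, hs⟩)
  rw [← hcard, ← card_sigma]
  refine card_le_card_of_injOn
    (fun p => ⟨charVec (A p.1 ∪ p.2), charVec (p.1 \ A p.1 ∪ p.2)⟩) ?_ ?_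
  · rintro ⟨e, B⟩ hp
    obtain ⟨he, hB⟩ := mem_sigma.1 hp
    obtain ⟨hBe, hBc⟩ := mem_powersetCard.1 hB
    simp only at he hBe hBc
    have hdisj : Disjoint e B := disjoint_left.2 fun v hv hvB => mem_compl.1 (hBe hvB) hv
    refine mem_sigma.2 ⟨hmem _ ?_, mem_filter.2 ⟨hmem _ ?_, ?_⟩⟩
    · rw [card_union_of_disjoint (hdisj.mono_left (hAe e)), hA e he, hBc]
      omega
    · rw [card_union_of_disjoint (hdisj.mono_left sdiff_subset), card_sdiff_of_subset (hAe e),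
        hA e he, hBc, hH e he]
      omega
    · rw [charVec_add, hdiff e B hBe]
      exact mem_image_of_mem _ he
  · rintro ⟨e, B⟩ hp ⟨e', B'⟩ hp' heq
    have hBe := (mem_powersetCard.1 (mem_sigma.1 (mem_coe.1 hp)).2).1
    have hBe' := (mem_powersetCard.1 (mem_sigma.1 (mem_coe.1 hp')).2).1
    simp only [Sigma.mk.injEq, heq_eq_eq] at heq hBe hBe'
    have h1 := charVec_injective heq.1
    have h2 := charVec_injective heq.2
    have hee : e = e' := by rw [← hdiff e B hBe, ← hdiff e' B' hBe', h1, h2]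
    subst hee
    have hBB : ∀ B : Finset α, B ⊆ eᶜ → B = (A e ∪ B) \ e := by
      intro B hB
      ext v
      have h1 : v ∈ A e → v ∈ e := fun h => hAe e h
      have h2 : v ∈ B → v ∉ e := fun h => mem_compl.1 (hB h)
      simp only [mem_union, mem_sdiff]
      tauto
    rw [hBB B hBe, hBB B' hBe', h1]

/-- A linear relation among characteristic vectors is an even cover. -/
lemma exists_evenCover_of_sum_eq_zero {H : Finset (Finset α)} {m : ℕ}
    (h : ∃ F ⊆ H.image charVec, F.Nonempty ∧ #F ≤ m ∧ ∑ e ∈ F, e = 0) :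
    ∃ F ⊆ H, F.Nonempty ∧ #F ≤ m ∧ ∀ v, Even #{e ∈ F | v ∈ e} := by
  obtain ⟨F, hFH, hne, hcard, hsum⟩ := h
  obtain ⟨G, hGH, rfl⟩ := subset_image_iff.1 hFH
  rw [card_image_of_injective _ charVec_injective] at hcard
  rw [sum_image charVec_injective.injOn] at hsum
  exact ⟨G, by exact_mod_cast hGH, image_nonempty.1 hne, hcard,
    even_card_filter_mem_of_sum_charVec hsum⟩

/-- A hypergraph with more edges than vertices has an even cover. -/
lemma exists_evenCover_of_card_lt {H : Finset (Finset α)} (hH : Fintype.card α < #H) :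
    ∃ F ⊆ H, F.Nonempty ∧ #F ≤ Fintype.card α + 1 ∧ ∀ v, Even #{e ∈ F | v ∈ e} := by
  refine exists_evenCover_of_sum_eq_zero ?_
  have := exists_sum_eq_zero_of_finrank_lt (E := H.image (charVec (α := α)))
    (by rwa [Module.finrank_fintype_fun_eq_card,
      card_image_of_injective _ charVec_injective])
  rwa [Module.finrank_fintype_fun_eq_card] at this

/-- A uniform hypergraph whose Kikuchi graph has large average degree has a short even cover. -/
lemma exists_evenCover_of_choose_le {H : Finset (Finset α)} {h ℓ r : ℕ} (hr : 0 < r)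
    (hℓ : h ≤ ℓ) (hℓn : ℓ ≤ Fintype.card α) (hH : ∀ e ∈ H, #e = 2 * h)
    (hlt : (Fintype.card α).choose ℓ < 2 ^ r)
    (hle : 32 * r * (Fintype.card α).choose ℓ ≤
      #H * (Fintype.card α - 2 * h).choose (ℓ - h)) :
    ∃ F ⊆ H, F.Nonempty ∧ #F ≤ 2 * r ∧ ∀ v, Even #{e ∈ F | v ∈ e} := by
  have hV : (charVecSlice α ℓ).Nonempty := by
    rw [← card_pos, card_charVecSlice]
    exact Nat.choose_pos hℓn
  obtain ⟨W, hWV, hW, hdeg⟩ := exists_minDegree_subset (H.image charVec) (a := 16 * r) hV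
    (by
      refine le_trans ?_ (card_mul_choose_le_sum_nbhd hℓ hH)
      rw [card_charVecSlice]
      exact hle.trans' (le_of_eq (by ring)))
  refine exists_evenCover_of_sum_eq_zero (exists_sum_eq_zero_of_minDegree hW hr ?_ hdeg)
  exact (card_le_card hWV).trans_lt (by rwa [card_charVecSlice])

end Slice

lemma choose_mul_choose_mul_choose {n h ℓ : ℕ} (hℓ : h ≤ ℓ) (hn : ℓ + h ≤ n) :
    n.choose ℓ * (ℓ.choose h * (n - ℓ).choose h) =
      (n - 2 * h).choose (ℓ - h) * (n.choose h * (n - h).choose h) := by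
  have h1 : n.choose ℓ * ℓ.choose h = n.choose h * (n - h).choose (ℓ - h) := Nat.choose_mul hℓ
  have h2 : (n - h).choose (n - ℓ) * (n - ℓ).choose h =
      (n - h).choose h * (n - h - h).choose (n - ℓ - h) := Nat.choose_mul (by omega)
  have h3 : (n - h).choose (n - ℓ) = (n - h).choose (ℓ - h) :=
    Nat.choose_symm_of_eq_add (by omega)
  have h4 : (n - h - h).choose (n - ℓ - h) = (n - 2 * h).choose (ℓ - h) := by
    rw [show n - h - h = n - 2 * h by omega]
    exact Nat.choose_symm_of_eq_add (by omega)
  rw [h3, h4] at h2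
  calc n.choose ℓ * (ℓ.choose h * (n - ℓ).choose h)
      = n.choose ℓ * ℓ.choose h * (n - ℓ).choose h := by ring
    _ = n.choose h * ((n - h).choose (ℓ - h) * (n - ℓ).choose h) := by rw [h1]; ring
    _ = _ := by rw [h2]; ring

/-- A lower bound for the density of the Kikuchi graph of a single edge. -/
lemma choose_mul_pow_le_choose_mul_pow {n h ℓ : ℕ} (hh : 0 < h) (hℓ : h ≤ ℓ) (hℓn : 2 * ℓ ≤ n)
    (hn : 4 * h ≤ n) :
    (n.choose ℓ : ℝ) * (ℓ : ℝ) ^ h ≤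
      (n - 2 * h).choose (ℓ - h) * (4 * h * n : ℝ) ^ h := by
  have hfac : (0 : ℝ) < (h.factorial : ℝ) := by exact_mod_cast h.factorial_pos
  have hn0 : (0 : ℝ) < n := by exact_mod_cast (by omega : 0 < n)
  have hh0 : (0 : ℝ) < h := by exact_mod_cast hh
  have hlow1 : ((ℓ : ℝ) / h) ^ h / h.factorial ≤ ℓ.choose h := by
    refine le_trans ?_ (Nat.pow_le_choose h ℓ)
    gcongr
    rw [div_le_iff₀ hh0, Nat.cast_sub (by omega)]
    push_cast
    have : (h : ℝ) ≤ ℓ := by exact_mod_cast hℓ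
    have : (1 : ℝ) ≤ h := by exact_mod_cast hh
    nlinarith
  have hlow2 : ((n : ℝ) / 4) ^ h / h.factorial ≤ (n - ℓ).choose h := by
    refine le_trans ?_ (Nat.pow_le_choose h (n - ℓ))
    gcongr
    rw [div_le_iff₀ (by norm_num)]
    exact_mod_cast (by omega : n ≤ (n - ℓ + 1 - h) * 4)
  have hup1 : (n.choose h : ℝ) ≤ (n : ℝ) ^ h / h.factorial := Nat.choose_le_pow_div h n
  have hup2 : ((n - h).choose h : ℝ) ≤ (n : ℝ) ^ h / h.factorial := by
    refine (Nat.choose_le_pow_div h (n - h)).trans ?_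
    gcongr
    omega
  have hid : (n.choose ℓ : ℝ) * (ℓ.choose h * (n - ℓ).choose h) =
      (n - 2 * h).choose (ℓ - h) * (n.choose h * (n - h).choose h) := by
    exact_mod_cast choose_mul_choose_mul_choose hℓ (by omega)
  have hmain : (n.choose ℓ : ℝ) *
        (((ℓ : ℝ) / h) ^ h / h.factorial * (((n : ℝ) / 4) ^ h / h.factorial)) ≤
      (n - 2 * h).choose (ℓ - h) *
        ((n : ℝ) ^ h / h.factorial * ((n : ℝ) ^ h / h.factorial)) := by
    calc _ ≤ (n.choose ℓ : ℝ) * (ℓ.choose h * (n - ℓ).choose h) := by gcongr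
      _ = _ := hid
      _ ≤ _ := by gcongr
  have hscale : 0 < (4 * h : ℝ) ^ h * h.factorial ^ 2 / (n : ℝ) ^ h := by positivity
  calc (n.choose ℓ : ℝ) * (ℓ : ℝ) ^ h
      = (n.choose ℓ : ℝ) * (((ℓ : ℝ) / h) ^ h / h.factorial * (((n : ℝ) / 4) ^ h / h.factorial)) *
          ((4 * h : ℝ) ^ h * h.factorial ^ 2 / (n : ℝ) ^ h) := by
        rw [div_pow, div_pow, mul_pow]
        field_simp
    _ ≤ (n - 2 * h).choose (ℓ - h) *
          ((n : ℝ) ^ h / h.factorial * ((n : ℝ) ^ h / h.factorial)) *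
          ((4 * h : ℝ) ^ h * h.factorial ^ 2 / (n : ℝ) ^ h) := by gcongr
    _ = (n - 2 * h).choose (ℓ - h) * (4 * h * n : ℝ) ^ h := by
        rw [mul_pow _ (n : ℝ)]
        field_simp


/-- For every even `k ≥ 2` there are constants `C, D > 0` such that for all
sufficiently large `n` and every `ℓ` with `k/2 ≤ ℓ ≤ n`, every `k`-uniform hypergraph on `n`
vertices with at least `C n (n/ℓ)^(k/2 - 1) log₂ n` hyperedges contains a nonempty collection
of at most `D ℓ log₂ n` distinct hyperedges covering every vertex an even number of times. -/
theorem even_cover_theorem (k : ℕ) (hk : 2 ≤ k) (hke : Even k) :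
    ∃ C > (0 : ℝ), ∃ D > (0 : ℝ), ∃ n₀ : ℕ, ∀ n : ℕ, n₀ ≤ n →
      ∀ ℓ : ℕ, k / 2 ≤ ℓ → ℓ ≤ n →
        ∀ H : Finset (Finset (Fin n)), (∀ E ∈ H, E.card = k) →
          C * (n : ℝ) * ((n : ℝ) / (ℓ : ℝ)) ^ (k / 2 - 1) * Real.logb 2 n ≤ (H.card : ℝ) →
          ∃ F ⊆ H, F.Nonempty ∧ ((F.card : ℝ) ≤ D * (ℓ : ℝ) * Real.logb 2 n) ∧
            ∀ v : Fin n, Even ((F.filter (fun E => v ∈ E)).card) := by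
  obtain ⟨h, hkh⟩ := hke
  have hk2 : k = 2 * h := by omega
  have hh : 0 < h := by omega
  have hh0 : (1 : ℝ) ≤ h := by exact_mod_cast hh
  refine ⟨64 * (4 * h) ^ h, by positivity, 4, by norm_num, 4 * h, ?_⟩
  intro n hn ℓ hℓ hℓn H hH hcard
  rw [show k / 2 = h by omega] at hℓ hcard
  set L := Real.logb 2 n with hL
  have hn2 : (2 : ℝ) ≤ n := by exact_mod_cast (by omega : 2 ≤ n)
  have hL1 : 1 ≤ L := by
    rw [hL, Real.le_logb_iff_rpow_le (by norm_num) (by linarith), Real.rpow_one]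
    exact hn2
  have hℓ1 : (1 : ℝ) ≤ ℓ := by exact_mod_cast (by omega : 1 ≤ ℓ)
  have hℓL : 1 ≤ ℓ * L := one_le_mul_of_one_le_of_one_le hℓ1 hL1
  suffices hF : ∃ m : ℕ, (m : ℝ) ≤ 4 * ℓ * L ∧
      ∃ F ⊆ H, F.Nonempty ∧ F.card ≤ m ∧ ∀ v, Even (F.filter (fun E => v ∈ E)).card by
    obtain ⟨m, hm, F, hFH, hne, hFm, heven⟩ := hF
    exact ⟨F, hFH, hne, le_trans (by exact_mod_cast hFm) hm, heven⟩
  by_cases hbig : 2 * ℓ ≤ n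
  · set r := ⌊ℓ * L⌋₊ + 1 with hr
    have hrlt : ℓ * L < r := by
      rw [hr]
      push_cast
      exact Nat.lt_floor_add_one _
    have hrle : (r : ℝ) ≤ 2 * (ℓ * L) := by
      have := Nat.floor_le (a := ℓ * L) (by linarith)
      rw [hr]
      push_cast
      linarith
    refine ⟨2 * r, by push_cast; linarith, ?_⟩
    refine exists_evenCover_of_choose_le (h := h) (ℓ := ℓ) (by omega) hℓ (by simpa using hℓn)
      (fun e he => (hH e he).trans hk2) ?_ ?_
    · have hchoose : (n.choose ℓ : ℝ) < 2 ^ r := by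
        calc (n.choose ℓ : ℝ) ≤ (n : ℝ) ^ ℓ := by exact_mod_cast Nat.choose_le_pow n ℓ
          _ = (2 : ℝ) ^ (ℓ * L) := by
            rw [mul_comm, Real.rpow_mul (by norm_num), hL,
              Real.rpow_logb (by norm_num) (by norm_num) (by linarith), Real.rpow_natCast]
          _ < (2 : ℝ) ^ (r : ℝ) := Real.rpow_lt_rpow_of_exponent_lt (by norm_num) hrlt
          _ = 2 ^ r := Real.rpow_natCast _ _
      rw [Fintype.card_fin]
      exact_mod_cast hchoose
    · rw [Fintype.card_fin]
      have hdens := choose_mul_pow_le_choose_mul_pow hh hℓ hbig hn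
      obtain ⟨j, rfl⟩ : ∃ j, h = j + 1 := ⟨h - 1, by omega⟩
      rw [Nat.add_sub_cancel] at hcard
      have hℓ0 : (0 : ℝ) < ℓ := by linarith
      have hn0 : (0 : ℝ) < n := by linarith
      have hreal : (32 * r * n.choose ℓ : ℝ) ≤
          H.card * (n - 2 * (j + 1)).choose (ℓ - (j + 1)) := by
        set c : ℝ := (((n - 2 * (j + 1)).choose (ℓ - (j + 1)) : ℕ) : ℝ)
        refine le_of_mul_le_mul_right ?_ (pow_pos hℓ0 (j + 1))
        calc (32 * r * n.choose ℓ : ℝ) * (ℓ : ℝ) ^ (j + 1)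
            = 32 * r * (n.choose ℓ * (ℓ : ℝ) ^ (j + 1)) := by ring
          _ ≤ 32 * (2 * (ℓ * L)) * (c * (4 * (j + 1 : ℕ) * n : ℝ) ^ (j + 1)) := by gcongr
          _ = 64 * (4 * (j + 1 : ℕ)) ^ (j + 1) * n * (n / ℓ) ^ j * L * c * ℓ ^ (j + 1) := by
            rw [mul_pow _ (n : ℝ), div_pow, pow_succ (n : ℝ), pow_succ (ℓ : ℝ)]
            field_simp
            ring
          _ ≤ H.card * c * ℓ ^ (j + 1) := by gcongr
      exact_mod_cast hreal
  · refine ⟨n + 1, ?_, ?_⟩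
    · have : (n : ℝ) + 1 ≤ 2 * ℓ := by exact_mod_cast (by omega : n + 1 ≤ 2 * ℓ)
      push_cast
      nlinarith
    · have hlt : (n : ℝ) < H.card := by
        have hdiv : (1 : ℝ) ≤ n / ℓ := by
          rw [one_le_div (by linarith)]
          exact_mod_cast hℓn
        have h1 : (1 : ℝ) ≤ (4 * h) ^ h := one_le_pow₀ (by linarith)
        calc (n : ℝ) < 64 * 1 * n * 1 * 1 := by linarith
          _ ≤ 64 * (4 * h) ^ h * n * (n / ℓ) ^ (h - 1) * L := by
            gcongr
            exact one_le_pow₀ hdiv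
          _ ≤ H.card := hcard
      have := exists_evenCover_of_card_lt (H := H)
        (by rw [Fintype.card_fin]; exact_mod_cast hlt)
      rwa [Fintype.card_fin] at this
end

section
/- For every ε with 0 < ε < 1/2 there exists n₀ such that for all n ≥ n₀, every properly edge-colored graph G on n vertices with at least (4/ε)·n·log(n) edges contains, for some integer k ≥ 3, a cycle of length k whose edges receive more than (1 − ε)·k distinct colors. -/
open Finset in
open scoped Classical in
theorem SimpleGraph.exists_le_forall_degree_eq_zero_or_le {V : Type*} [Fintype V] {δ : ℝ}
    (hδ : 0 ≤ δ) (s : Finset V) (G : SimpleGraph V) (hs : ∀ a b, G.Adj a b → a ∈ s)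
    (hpos : 0 < G.edgeSet.ncard) (hG : δ * #s ≤ G.edgeSet.ncard) :
    ∃ H ≤ G, 0 < H.edgeSet.ncard ∧ ∀ v, H.degree v = 0 ∨ δ ≤ H.degree v := by
  induction s using Finset.strongInduction generalizing G with
  | H s ih =>
    by_cases h : ∀ v, G.degree v = 0 ∨ δ ≤ G.degree v
    · exact ⟨G, le_rfl, hpos, h⟩
    push Not at h
    obtain ⟨v, hv0, hv⟩ := h
    have hvs : v ∈ s := by
      obtain ⟨w, hw⟩ := (G.degree_pos_iff_exists_adj v).1 (Nat.pos_of_ne_zero hv0)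
      exact hs v w hw
    have hcard : G.edgeSet.ncard ≤ (G.deleteIncidenceSet v).edgeSet.ncard + G.degree v := by
      have := G.card_edgeFinset_deleteIncidenceSet v
      rw [← Set.ncard_coe_finset, ← Set.ncard_coe_finset, SimpleGraph.coe_edgeFinset,
        SimpleGraph.coe_edgeFinset] at this
      omega
    have hcard' : (G.edgeSet.ncard : ℝ) ≤ (G.deleteIncidenceSet v).edgeSet.ncard + G.degree v := by
      exact_mod_cast hcard
    have herase : (#(s.erase v) : ℝ) + 1 = #s := by
      exact_mod_cast Finset.card_erase_add_one hvs
    have hlt : δ * #(s.erase v) < (G.deleteIncidenceSet v).edgeSet.ncard := by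
      rw [← herase] at hG
      linarith
    obtain ⟨H, hH, h⟩ := ih (s.erase v) (Finset.erase_ssubset hvs) (G.deleteIncidenceSet v)
      (fun a b hab => by
        rw [SimpleGraph.deleteIncidenceSet_adj] at hab
        exact Finset.mem_erase.2 ⟨hab.2.1, hs a b hab.1⟩)
      (by exact_mod_cast (mul_nonneg hδ (Nat.cast_nonneg _)).trans_lt hlt) hlt.le
    exact ⟨H, hH.trans (G.deleteIncidenceSet_le v), h⟩

open Finset in
theorem Fin.le_card_image_add_card_pairs {L : ℕ} (f : Fin L → ℕ) :
    L ≤ #(univ.image f) + #{p : Fin L × Fin L | p.1 < p.2 ∧ f p.1 = f p.2} := by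
  set A : Finset (Fin L) := {j | ∀ i < j, f i ≠ f j}
  have hA : #A ≤ #(univ.image f) := by
    refine Finset.card_le_card_of_injOn f (fun i _ => by simp) ?_
    intro i hi j hj hij
    simp only [A, coe_filter, mem_univ, true_and, Set.mem_ofPred_eq] at hi hj
    rcases lt_trichotomy i j with h | h | h
    · exact absurd hij (hj i h)
    · exact h
    · exact absurd hij.symm (hi j h)
  have hB : #Aᶜ ≤ #{p : Fin L × Fin L | p.1 < p.2 ∧ f p.1 = f p.2} := by
    refine (Finset.card_le_card ?_).trans (Finset.card_image_le (f := Prod.snd))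
    intro j hj
    simp only [A, mem_compl, mem_filter, mem_univ, true_and] at hj
    push Not at hj
    obtain ⟨i, hij, h⟩ := hj
    exact mem_image.2 ⟨(i, j), by simp [hij, h], rfl⟩
  have := Finset.card_add_card_compl A
  rw [Fintype.card_fin] at this
  omega

open Finset in
/-- If every cycle of `G` has at most `r` times as many colors as edges, then removing closed pieces
from a walk until it becomes a path removes few colors. -/
theorem SimpleGraph.Walk.exists_isPath_colors_subset {V : Type*} {G : SimpleGraph V}
    {c : Sym2 V → ℕ} {r : ℝ} (hr : 1 ≤ r * 2)
    (hcyc : ∀ (v : V) (w : G.Walk v v), w.IsCycle →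
      (#(w.edges.map c).toFinset : ℝ) ≤ r * w.length) {u v : V} (p : G.Walk u v) :
    ∃ q : G.Walk u v, q.IsPath ∧ ∃ X : Finset ℕ,
      (p.edges.map c).toFinset ⊆ (q.edges.map c).toFinset ∪ X ∧
      (#X : ℝ) ≤ r * (p.length - q.length) := by
  classical
  induction p with
  | nil => exact ⟨.nil, .nil, ∅, by simp, by simp⟩
  | @cons u v w h p ih =>
    obtain ⟨q, hq, X, hsub, hX⟩ := ih
    by_cases hu : u ∈ q.support
    · have hcol : (#((Walk.cons h (q.takeUntil u hu)).edges.map c).toFinset : ℝ) ≤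
          r * (Walk.cons h (q.takeUntil u hu)).length := by
        by_cases he : s(u, v) ∈ (q.takeUntil u hu).edges
        · have hl := (hq.takeUntil hu).length_eq_one_of_mem_edges (Sym2.eq_swap ▸ he)
          have h1 : #((Walk.cons h (q.takeUntil u hu)).edges.map c).toFinset ≤ 1 := by
            have : ((Walk.cons h (q.takeUntil u hu)).edges.map c).toFinset =
                ((q.takeUntil u hu).edges.map c).toFinset := by
              simp only [Walk.edges_cons, List.map_cons, List.toFinset_cons]
              exact Finset.insert_eq_of_mem (by simpa using ⟨_, he, rfl⟩)
            rw [this]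
            refine (List.toFinset_card_le _).trans ?_
            simp [hl]
          have h1' : (#((Walk.cons h (q.takeUntil u hu)).edges.map c).toFinset : ℝ) ≤ 1 := by
            exact_mod_cast h1
          rw [Walk.length_cons, hl]
          push_cast
          linarith
        · exact hcyc u _ ((Walk.cons_isCycle_iff _ _).2 ⟨hq.takeUntil hu, he⟩)
      refine ⟨q.dropUntil u hu, hq.dropUntil hu,
        ((Walk.cons h (q.takeUntil u hu)).edges.map c).toFinset ∪ X, ?_, ?_⟩
      · intro x hx
        simp only [Walk.edges_cons, List.map_cons, List.toFinset_cons, mem_insert] at hx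
        rcases hx with rfl | hx
        · simp
        · have := hsub hx
          rw [← q.take_spec hu, Walk.edges_append, List.map_append, List.toFinset_append] at this
          simp only [mem_union, Walk.edges_cons, List.map_cons, List.toFinset_cons,
            mem_insert] at this ⊢
          tauto
      · have hlen := congrArg Walk.length (q.take_spec hu)
        rw [Walk.length_append] at hlen
        have hlen' : ((q.takeUntil u hu).length : ℝ) + (q.dropUntil u hu).length = q.length := by
          exact_mod_cast hlen
        have hun : (#(((Walk.cons h (q.takeUntil u hu)).edges.map c).toFinset ∪ X) : ℝ) ≤
            #((Walk.cons h (q.takeUntil u hu)).edges.map c).toFinset + #X := by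
          exact_mod_cast Finset.card_union_le _ _
        rw [Walk.length_cons] at hcol ⊢
        push_cast at hcol ⊢
        rw [← hlen'] at hX
        linarith
    · refine ⟨.cons h q, (Walk.cons_isPath_iff _ _).2 ⟨hq, hu⟩, X, ?_, ?_⟩
      · simp only [Walk.edges_cons, List.map_cons, List.toFinset_cons, Finset.insert_union]
        exact Finset.insert_subset_insert _ hsub
      · simpa using hX

open Finset in
theorem SimpleGraph.Walk.exists_isCycle_lt_card_colors {V : Type*} {G : SimpleGraph V}
    {c : Sym2 V → ℕ} {r : ℝ} (hr : 1 ≤ r * 2) {v : V} (p : G.Walk v v)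
    (hp : r * p.length < #(p.edges.map c).toFinset) :
    ∃ (v : V) (w : G.Walk v v), w.IsCycle ∧ r * w.length < #(w.edges.map c).toFinset := by
  by_contra! hcyc
  obtain ⟨q, hq, X, hsub, hX⟩ := p.exists_isPath_colors_subset hr hcyc
  obtain rfl := (Walk.isPath_iff_nil.1 hq).eq_nil
  have : (#(p.edges.map c).toFinset : ℝ) ≤ #X := by
    exact_mod_cast Finset.card_le_card (by simpa using hsub)
  simp only [Walk.length_nil, Nat.cast_zero, sub_zero] at hX
  linarith

theorem SimpleGraph.exists_walk_edges_eq_ofFn {V : Type*} {G : SimpleGraph V} {L : ℕ}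
    (w : Fin (L + 1) → V) (hw : ∀ i : Fin L, G.Adj (w i.castSucc) (w i.succ)) :
    ∃ p : G.Walk (w 0) (w (Fin.last L)),
      p.edges = List.ofFn fun i : Fin L => s(w i.castSucc, w i.succ) := by
  induction L with
  | zero => exact ⟨.nil, by simp⟩
  | succ L ih =>
    obtain ⟨p, hp⟩ := ih (fun i => w i.succ) fun i => hw i.succ
    refine ⟨.cons (hw 0) p, ?_⟩
    rw [List.ofFn_succ]
    exact congrArg (s(w 0, w 1) :: ·) hp

theorem pow_mul_pow_add_le (x y : ℝ) {a b l : ℕ} (h : a + b = 2 * l) :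
    x ^ a * y ^ b + y ^ a * x ^ b ≤ x ^ (2 * l) + y ^ (2 * l) := by
  have key : 0 ≤ (|x| ^ a - |y| ^ a) * (|x| ^ b - |y| ^ b) := by
    rcases le_total |x| |y| with hxy | hxy
    · exact mul_nonneg_of_nonpos_of_nonpos
        (sub_nonpos.2 (pow_le_pow_left₀ (abs_nonneg _) hxy _))
        (sub_nonpos.2 (pow_le_pow_left₀ (abs_nonneg _) hxy _))
    · exact mul_nonneg
        (sub_nonneg.2 (pow_le_pow_left₀ (abs_nonneg _) hxy _))
        (sub_nonneg.2 (pow_le_pow_left₀ (abs_nonneg _) hxy _))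
  have hx : x ^ (2 * l) = |x| ^ a * |x| ^ b := by
    rw [← pow_add, h, pow_mul, pow_mul, sq_abs]
  have hy : y ^ (2 * l) = |y| ^ a * |y| ^ b := by
    rw [← pow_add, h, pow_mul, pow_mul, sq_abs]
  have h1 : x ^ a * y ^ b ≤ |x| ^ a * |y| ^ b := by
    simpa [abs_mul, abs_pow] using le_abs_self (x ^ a * y ^ b)
  have h2 : y ^ a * x ^ b ≤ |y| ^ a * |x| ^ b := by
    simpa [abs_mul, abs_pow] using le_abs_self (y ^ a * x ^ b)
  rw [hx, hy]
  nlinarith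

theorem mul_pow_le_mul_pow_succ_add_one (m : ℕ) {y : ℝ} (hy : 0 ≤ y) :
    (m + 1) * y ^ m ≤ m * y ^ (m + 1) + 1 := by
  induction m with
  | zero => simp
  | succ m ih =>
    have h1 : 0 ≤ (y ^ (m + 1) - 1) * (y - 1) := by
      rcases le_total y 1 with h | h
      · exact mul_nonneg_of_nonpos_of_nonpos (sub_nonpos.2 (pow_le_one₀ hy h)) (sub_nonpos.2 h)
      · exact mul_nonneg (sub_nonneg.2 (one_le_pow₀ h)) (sub_nonneg.2 h)
    have := mul_le_mul_of_nonneg_left ih hy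
    rw [pow_succ y (m + 1), pow_succ y m] at *
    push_cast
    nlinarith

namespace Matrix

variable {V : Type*} [Fintype V] [DecidableEq V]

theorem IsSymm.exists_eq_mul_diagonal_mul_transpose {A : Matrix V V ℝ} (hA : A.IsSymm) :
    ∃ (U : Matrix V V ℝ) (d : V → ℝ), Uᵀ * U = 1 ∧ U * Uᵀ = 1 ∧ A = U * diagonal d * Uᵀ := by
  have hA' : A.IsHermitian := by
    rw [IsHermitian, conjTranspose_eq_transpose_of_trivial]
    exact hA
  refine ⟨hA'.eigenvectorUnitary, hA'.eigenvalues, ?_, ?_, ?_⟩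
  · have := Unitary.coe_star_mul_self hA'.eigenvectorUnitary
    rwa [star_eq_conjTranspose, conjTranspose_eq_transpose_of_trivial] at this
  · have := Unitary.coe_mul_star_self hA'.eigenvectorUnitary
    rwa [Unitary.coe_star, star_eq_conjTranspose, conjTranspose_eq_transpose_of_trivial] at this
  · have := hA'.spectral_theorem
    rw [Unitary.conjStarAlgAut_apply, star_eq_conjTranspose,
      conjTranspose_eq_transpose_of_trivial] at this
    exact this

theorem mul_diagonal_mul_transpose_pow {U : Matrix V V ℝ} {d : V → ℝ} (hU : Uᵀ * U = 1)
    (hU' : U * Uᵀ = 1) (a : ℕ) :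
    (U * diagonal d * Uᵀ) ^ a = U * diagonal (fun i => d i ^ a) * Uᵀ := by
  induction a with
  | zero => simp [hU']
  | succ a ih =>
    rw [pow_succ, ih]
    calc U * diagonal (fun i => d i ^ a) * Uᵀ * (U * diagonal d * Uᵀ)
        = U * diagonal (fun i => d i ^ a) * (Uᵀ * U) * diagonal d * Uᵀ := by
          simp only [Matrix.mul_assoc]
      _ = _ := by
          rw [hU, Matrix.mul_one, Matrix.mul_assoc U, diagonal_mul_diagonal]
          simp only [pow_succ]

theorem trace_mul_pow_mul_pow_le {A B : Matrix V V ℝ} (hA : A.IsSymm) (hB : B.IsSymm)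
    {a b l : ℕ} (h : a + b = 2 * l) :
    (B * A ^ a * B * A ^ b).trace ≤ (B * B * A ^ (2 * l)).trace := by
  obtain ⟨U, d, hU, hU', rfl⟩ := hA.exists_eq_mul_diagonal_mul_transpose
  set C := Uᵀ * B * U with hC
  have hCs (i j : V) : C j i = C i j := by
    have : Cᵀ = C := by
      rw [hC, transpose_mul, transpose_mul, transpose_transpose, hB.eq, Matrix.mul_assoc]
    exact congrFun (congrFun this i) j
  have key (a b : ℕ) : (B * (U * diagonal d * Uᵀ) ^ a * B * (U * diagonal d * Uᵀ) ^ b).trace =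
      ∑ i, ∑ j, C i j ^ 2 * (d j ^ a * d i ^ b) := by
    rw [mul_diagonal_mul_transpose_pow hU hU', mul_diagonal_mul_transpose_pow hU hU']
    have : (B * (U * diagonal (fun i => d i ^ a) * Uᵀ) * B *
        (U * diagonal (fun i => d i ^ b) * Uᵀ)).trace =
        (C * diagonal (fun i => d i ^ a) * (C * diagonal (fun i => d i ^ b))).trace := by
      rw [← Matrix.mul_assoc, trace_mul_comm]
      simp only [hC, Matrix.mul_assoc]
    rw [this, trace]
    refine Finset.sum_congr rfl fun i _ => ?_
    rw [diag_apply, mul_apply]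
    refine Finset.sum_congr rfl fun j _ => ?_
    rw [mul_diagonal, mul_diagonal, hCs i j]
    ring
  have key0 : (B * B * (U * diagonal d * Uᵀ) ^ (2 * l)).trace =
      ∑ i, ∑ j, C i j ^ 2 * (d j ^ 0 * d i ^ (2 * l)) := by
    rw [← key, pow_zero, Matrix.mul_one]
  rw [key, key0]
  have swap (a b : ℕ) : ∑ i, ∑ j, C i j ^ 2 * (d j ^ a * d i ^ b) =
      ∑ i, ∑ j, C i j ^ 2 * (d i ^ a * d j ^ b) := by
    rw [Finset.sum_comm]
    exact Finset.sum_congr rfl fun i _ => Finset.sum_congr rfl fun j _ => by rw [hCs]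
  have : ∑ i, ∑ j, C i j ^ 2 * (d j ^ a * d i ^ b) + ∑ i, ∑ j, C i j ^ 2 * (d i ^ a * d j ^ b) ≤
      ∑ i, ∑ j, C i j ^ 2 * (d j ^ 0 * d i ^ (2 * l)) +
        ∑ i, ∑ j, C i j ^ 2 * (d i ^ 0 * d j ^ (2 * l)) := by
    simp only [← Finset.sum_add_distrib, ← mul_add]
    refine Finset.sum_le_sum fun i _ => Finset.sum_le_sum fun j _ =>
      mul_le_mul_of_nonneg_left ?_ (sq_nonneg _)
    have := pow_mul_pow_add_le (d j) (d i) h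
    rw [pow_zero, pow_zero, one_mul, one_mul]
    linarith
  rw [← swap, ← swap] at this
  linarith

theorem trace_pow_le_mul_trace_pow {A : Matrix V V ℝ} (hA : A.IsSymm) (φ : V → ℝ) (hφ : φ ≠ 0)
    (hAφ : A *ᵥ φ = φ) {t : ℝ} (ht : 0 < t) {m : ℕ} (hm : (Fintype.card V : ℝ) ≤ t ^ (m + 1)) :
    0 < (A ^ (2 * (m + 1))).trace ∧
      (A ^ (2 * m)).trace ≤ t * (A ^ (2 * (m + 1))).trace := by
  obtain ⟨U, d, hU, hU', rfl⟩ := hA.exists_eq_mul_diagonal_mul_transpose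
  have key (a : ℕ) : ((U * diagonal d * Uᵀ) ^ (2 * a)).trace = ∑ i, (d i ^ 2) ^ a := by
    rw [mul_diagonal_mul_transpose_pow hU hU', Matrix.mul_assoc, trace_mul_comm,
      Matrix.mul_assoc, hU, Matrix.mul_one, trace_diagonal]
    simp only [pow_mul]
  have heig : ∃ i, d i = 1 := by
    have hψ : Uᵀ *ᵥ φ ≠ 0 := by
      intro h0
      apply hφ
      rw [← one_mulVec φ, ← hU', ← mulVec_mulVec, h0, mulVec_zero]
    obtain ⟨i, hi⟩ := Function.ne_iff.1 hψ
    refine ⟨i, ?_⟩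
    have h1 : diagonal d *ᵥ (Uᵀ *ᵥ φ) = Uᵀ *ᵥ φ := by
      conv_rhs => rw [← hAφ]
      rw [mulVec_mulVec, mulVec_mulVec, ← Matrix.mul_assoc, ← Matrix.mul_assoc, hU, Matrix.one_mul]
    have h2 := congrFun h1 i
    rw [mulVec_diagonal] at h2
    exact mul_right_cancel₀ hi (by rw [h2, one_mul])
  obtain ⟨i₀, hi₀⟩ := heig
  have hT : 1 ≤ ∑ i, (d i ^ 2) ^ (m + 1) := by
    have := Finset.single_le_sum (f := fun i => (d i ^ 2) ^ (m + 1)) (fun i _ => by positivity)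
      (Finset.mem_univ i₀)
    simpa [hi₀] using this
  rw [key, key]
  refine ⟨by linarith, ?_⟩
  have hsum : ∑ i, (m + 1) * (t * d i ^ 2) ^ m ≤ ∑ i, (m * (t * d i ^ 2) ^ (m + 1) + 1) :=
    Finset.sum_le_sum fun i _ => mul_pow_le_mul_pow_succ_add_one m (by positivity)
  simp only [mul_pow t, Finset.sum_add_distrib, ← Finset.mul_sum] at hsum
  simp only [Finset.sum_const, Finset.card_univ, nsmul_eq_mul, mul_one] at hsum
  have htm : 0 < t ^ m := by positivity
  have : (m + 1) * (t ^ m * ∑ i, (d i ^ 2) ^ m) ≤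
      (m + 1) * (t ^ m * (t * ∑ i, (d i ^ 2) ^ (m + 1))) := by
    have h3 : t ^ (m + 1) ≤ t ^ (m + 1) * ∑ i, (d i ^ 2) ^ (m + 1) :=
      le_mul_of_one_le_right (by positivity) hT
    rw [← mul_assoc (t ^ m), ← pow_succ]
    linarith
  exact le_of_mul_le_mul_left (le_of_mul_le_mul_left this (by positivity)) htm

/-- The product `M 0 * M 1 * ⋯ * M (m - 1)`. -/
def seqProd (M : ℕ → Matrix V V ℝ) : ℕ → Matrix V V ℝ
  | 0 => 1
  | m + 1 => seqProd M m * M m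

theorem seqProd_apply (M : ℕ → Matrix V V ℝ) (m : ℕ) (u v : V) :
    seqProd M m u v = ∑ w : Fin (m + 1) → V, if w 0 = u ∧ w (Fin.last m) = v then
      ∏ i : Fin m, M i (w i.castSucc) (w i.succ) else 0 := by
  induction m generalizing v with
  | zero =>
    rw [← (Equiv.funUnique (Fin 1) V).symm.sum_comp]
    simp [seqProd, one_apply, Finset.filter_and, Finset.filter_eq']
    split_ifs <;> simp_all
  | succ m ih =>
    rw [← (Fin.snocEquiv fun _ : Fin (m + 2) => V).sum_comp, Fintype.sum_prod_type]
    simp only [seqProd, mul_apply, ih, Fin.snocEquiv, Equiv.coe_fn_mk, Fin.snoc_last]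
    symm
    rw [Finset.sum_eq_single v (fun x _ hx => by simp [hx]) (by simp)]
    simp only [Finset.sum_mul]
    rw [Finset.sum_comm]
    refine Finset.sum_congr rfl fun w _ => ?_
    symm
    rw [Finset.sum_eq_single (w (Fin.last m)) (fun x _ hx => by simp [hx.symm]) (by simp)]
    have h0 : (Fin.snoc w v : Fin (m + 2) → V) 0 = w 0 :=
      Fin.snoc_castSucc (α := fun _ => V) v w 0
    simp only [h0, and_true, Fin.prod_univ_castSucc, Fin.snoc_castSucc, Fin.succ_last,
      Fin.snoc_last, Fin.val_castSucc, Fin.val_last, ite_mul, zero_mul, Fin.succ_castSucc]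

theorem trace_seqProd (M : ℕ → Matrix V V ℝ) (m : ℕ) :
    (seqProd M m).trace = ∑ w : Fin (m + 1) → V, if w 0 = w (Fin.last m) then
      ∏ i : Fin m, M i (w i.castSucc) (w i.succ) else 0 := by
  simp only [trace, diag_apply, seqProd_apply]
  rw [Finset.sum_comm]
  refine Finset.sum_congr rfl fun w _ => ?_
  rw [Finset.sum_eq_single (w 0) (fun x _ hx => by simp [hx.symm]) (by simp)]
  simp [eq_comm]

theorem seqProd_const (A : Matrix V V ℝ) (m : ℕ) : seqProd (fun _ => A) m = A ^ m := by
  induction m with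
  | zero => rfl
  | succ m ih => rw [seqProd, ih, pow_succ]

theorem seqProd_two_factors (A B : Matrix V V ℝ) {i j : ℕ} (hij : i < j) (m : ℕ) :
    seqProd (fun l => if l = i ∨ l = j then B else A) (j + 1 + m) =
      A ^ i * B * A ^ (j - i - 1) * B * A ^ m := by
  set M : ℕ → Matrix V V ℝ := fun l => if l = i ∨ l = j then B else A
  have h1 (l : ℕ) (hl : l ≤ i) : seqProd M l = A ^ l := by
    induction l with
    | zero => rfl
    | succ l ih =>
      rw [seqProd, ih (by omega), pow_succ]
      simp [M, show l ≠ i by omega, show l ≠ j by omega]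
  have h2 (l : ℕ) (hl : i + 1 + l ≤ j) : seqProd M (i + 1 + l) = A ^ i * B * A ^ l := by
    induction l with
    | zero => simp [seqProd, h1 i le_rfl, M]
    | succ l ih =>
      rw [← add_assoc, seqProd, ih (by omega), pow_succ]
      simp [M, show i + 1 + l ≠ i by omega, show i + 1 + l ≠ j by omega, Matrix.mul_assoc]
  induction m with
  | zero =>
    have := h2 (j - i - 1) (by omega)
    rw [show i + 1 + (j - i - 1) = j by omega] at this
    simp [seqProd, this, M]
  | succ m ih =>
    rw [← add_assoc, seqProd, ih, pow_succ]
    simp [M, show j + 1 + m ≠ i by omega, show j + 1 + m ≠ j by omega, Matrix.mul_assoc]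

theorem trace_seqProd_two_factors_le {A B : Matrix V V ℝ} (hA : A.IsSymm) (hB : B.IsSymm)
    {i j l : ℕ} (hij : i < j) (hj : j < 2 * (l + 1)) :
    (seqProd (fun k => if k = i ∨ k = j then B else A) (2 * (l + 1))).trace ≤
      (B * B * A ^ (2 * l)).trace := by
  have := seqProd_two_factors A B hij (2 * (l + 1) - (j + 1))
  rw [show j + 1 + (2 * (l + 1) - (j + 1)) = 2 * (l + 1) by omega] at this
  rw [this, Matrix.mul_assoc, Matrix.mul_assoc, Matrix.mul_assoc, trace_mul_comm]
  have key := trace_mul_pow_mul_pow_le hA hB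
    (show (j - i - 1) + (2 * (l + 1) - (j + 1) + i) = 2 * l by omega)
  rw [pow_add] at key
  simpa only [Matrix.mul_assoc] using key

end Matrix

theorem Fin.card_pairs_lt_mul_two (L : ℕ) :
    Finset.card {p : Fin L × Fin L | p.1 < p.2} * 2 = L * (L - 1) := by
  have : Finset.card {p : Fin L × Fin L | p.1 < p.2} = ∑ j : Fin L, (j : ℕ) := by
    rw [Finset.card_filter, Fintype.sum_prod_type_right]
    refine Finset.sum_congr rfl fun j _ => ?_
    rw [← Finset.card_filter, Finset.filter_gt_eq_Iio, Fin.card_Iio]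
  rw [this, Fin.sum_univ_eq_sum_range (fun i => i), Finset.sum_range_id_mul_two]

namespace SimpleGraph

variable {V : Type*} [Fintype V] (G : SimpleGraph V) [DecidableRel G.Adj]

/-- The adjacency matrix normalized as `D ^ (-1/2) * A * D ^ (-1/2)`. -/
noncomputable def normAdjMatrix : Matrix V V ℝ :=
  .of fun u v => if G.Adj u v then (√(G.degree u))⁻¹ * (√(G.degree v))⁻¹ else 0

/-- The part of the normalized adjacency matrix supported on the edges of color `k`. -/
noncomputable def colorAdjMatrix (c : Sym2 V → ℕ) (k : ℕ) : Matrix V V ℝ :=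
  .of fun u v => if c s(u, v) = k then G.normAdjMatrix u v else 0

theorem normAdjMatrix_nonneg (u v : V) : 0 ≤ G.normAdjMatrix u v := by
  simp only [normAdjMatrix, Matrix.of_apply]
  split_ifs <;> positivity

theorem isSymm_normAdjMatrix : G.normAdjMatrix.IsSymm := by
  ext u v
  simp only [normAdjMatrix, Matrix.transpose_apply, Matrix.of_apply, G.adj_comm, mul_comm]

theorem isSymm_colorAdjMatrix (c : Sym2 V → ℕ) (k : ℕ) : (G.colorAdjMatrix c k).IsSymm := by
  ext u v
  simp only [colorAdjMatrix, Matrix.transpose_apply, Matrix.of_apply, Sym2.eq_swap (a := v),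
    G.isSymm_normAdjMatrix.apply]

theorem normAdjMatrix_mulVec_sqrt_degree :
    G.normAdjMatrix.mulVec (fun v => √(G.degree v)) = fun v => √(G.degree v) := by
  ext u
  have (v : V) : G.normAdjMatrix u v * √(G.degree v) =
      if G.Adj u v then (√(G.degree u))⁻¹ else 0 := by
    simp only [normAdjMatrix, Matrix.of_apply]
    split_ifs with h
    · have : 0 < G.degree v := (G.degree_pos_iff_exists_adj v).2 ⟨u, h.symm⟩
      have : 0 < √(G.degree v : ℝ) := Real.sqrt_pos.2 (by exact_mod_cast this)
      field_simp
    · simp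
  simp only [Matrix.mulVec, dotProduct, this]
  rw [← Finset.sum_filter, Finset.sum_const, ← neighborFinset_eq_filter,
    card_neighborFinset_eq_degree, nsmul_eq_mul, ← div_eq_mul_inv, Real.div_sqrt]

theorem sum_normAdjMatrix_sq_le {δ : ℝ} (hδ : 0 < δ)
    (hdeg : ∀ v, G.degree v = 0 ∨ δ ≤ G.degree v) (u : V) :
    ∑ v, G.normAdjMatrix u v ^ 2 ≤ δ⁻¹ := by
  have (v : V) : G.normAdjMatrix u v ^ 2 ≤
      if G.Adj u v then (G.degree u : ℝ)⁻¹ * δ⁻¹ else 0 := by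
    simp only [normAdjMatrix, Matrix.of_apply]
    split_ifs with h
    · have h0 : 0 < G.degree v := (G.degree_pos_iff_exists_adj v).2 ⟨u, h.symm⟩
      rw [mul_pow, inv_pow, inv_pow, Real.sq_sqrt (Nat.cast_nonneg _),
        Real.sq_sqrt (Nat.cast_nonneg _)]
      gcongr
      exact (hdeg v).resolve_left h0.ne'
    · simp
  refine (Finset.sum_le_sum fun v _ => this v).trans ?_
  rw [← Finset.sum_filter, Finset.sum_const, ← neighborFinset_eq_filter,
    card_neighborFinset_eq_degree, nsmul_eq_mul, ← mul_assoc]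
  exact mul_le_of_le_one_left (by positivity) mul_inv_le_one

variable [DecidableEq V]

theorem normAdjMatrix_pow_nonneg (m : ℕ) (u v : V) : 0 ≤ (G.normAdjMatrix ^ m) u v := by
  induction m generalizing v with
  | zero => simp only [pow_zero, Matrix.one_apply]; split_ifs <;> simp
  | succ m ih =>
    rw [pow_succ, Matrix.mul_apply]
    exact Finset.sum_nonneg fun x _ => mul_nonneg (ih x) (G.normAdjMatrix_nonneg x v)

theorem colorAdjMatrix_mul_self {c : Sym2 V → ℕ}
    (hc : ∀ a b b', G.Adj a b → G.Adj a b' → b ≠ b' → c s(a, b) ≠ c s(a, b')) (k : ℕ) :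
    G.colorAdjMatrix c k * G.colorAdjMatrix c k =
      Matrix.diagonal fun u => ∑ v, if c s(u, v) = k then G.normAdjMatrix u v ^ 2 else 0 := by
  ext u w
  rw [Matrix.mul_apply, Matrix.diagonal_apply]
  split_ifs with huw
  · subst huw
    refine Finset.sum_congr rfl fun v _ => ?_
    rw [(G.isSymm_colorAdjMatrix c k).apply u v]
    simp only [colorAdjMatrix, Matrix.of_apply]
    split_ifs <;> ring
  · refine Finset.sum_eq_zero fun v _ => ?_
    by_contra h
    obtain ⟨h1, h2⟩ := mul_ne_zero_iff.1 h
    simp only [colorAdjMatrix, normAdjMatrix, Matrix.of_apply, ne_eq, ite_eq_right_iff,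
      Classical.not_imp] at h1 h2
    refine hc v u w h1.2.1.symm h2.2.1 huw ?_
    rw [h2.1, Sym2.eq_swap, h1.1]

theorem sum_trace_colorAdjMatrix_le {c : Sym2 V → ℕ}
    (hc : ∀ a b b', G.Adj a b → G.Adj a b' → b ≠ b' → c s(a, b) ≠ c s(a, b'))
    {δ : ℝ} (hδ : 0 < δ) (hdeg : ∀ v, G.degree v = 0 ∨ δ ≤ G.degree v) (m : ℕ) :
    ∑ k ∈ Finset.univ.image c,
      (G.colorAdjMatrix c k * G.colorAdjMatrix c k * G.normAdjMatrix ^ m).trace ≤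
      δ⁻¹ * (G.normAdjMatrix ^ m).trace := by
  simp only [G.colorAdjMatrix_mul_self hc, Matrix.trace, Matrix.diag_apply, Matrix.diagonal_mul]
  rw [Finset.sum_comm, Finset.mul_sum]
  refine Finset.sum_le_sum fun u _ => ?_
  rw [← Finset.sum_mul]
  refine mul_le_mul_of_nonneg_right ?_ (G.normAdjMatrix_pow_nonneg m u u)
  rw [Finset.sum_comm]
  refine (Finset.sum_le_sum fun v _ => ?_).trans (G.sum_normAdjMatrix_sq_le hδ hdeg u)
  rw [Finset.sum_ite_eq, if_pos (Finset.mem_image_of_mem c (Finset.mem_univ _))]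

/-- The weight of a closed walk, given by its vertex sequence. -/
noncomputable def closedWalkWeight {L : ℕ} (w : Fin (L + 1) → V) : ℝ :=
  if w 0 = w (Fin.last L) then ∏ i : Fin L, G.normAdjMatrix (w i.castSucc) (w i.succ) else 0

theorem closedWalkWeight_nonneg {L : ℕ} (w : Fin (L + 1) → V) : 0 ≤ G.closedWalkWeight w := by
  rw [closedWalkWeight]
  split_ifs
  · exact Finset.prod_nonneg fun i _ => G.normAdjMatrix_nonneg _ _
  · rfl

theorem sum_closedWalkWeight (L : ℕ) :
    ∑ w : Fin (L + 1) → V, G.closedWalkWeight w = (G.normAdjMatrix ^ L).trace := by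
  rw [← Matrix.seqProd_const, Matrix.trace_seqProd]
  rfl

theorem sum_closedWalkWeight_eq_color (c : Sym2 V → ℕ) {L : ℕ} (i j : Fin L) :
    ∑ w : Fin (L + 1) → V, (if c s(w i.castSucc, w i.succ) = c s(w j.castSucc, w j.succ) then
      G.closedWalkWeight w else 0) =
    ∑ k ∈ Finset.univ.image c, (Matrix.seqProd (fun l => if l = i ∨ l = j then
      G.colorAdjMatrix c k else G.normAdjMatrix) L).trace := by
  simp only [Matrix.trace_seqProd]
  rw [Finset.sum_comm]
  refine Finset.sum_congr rfl fun w _ => ?_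
  have key (k : ℕ) : ∏ l : Fin L, (if (l : ℕ) = i ∨ (l : ℕ) = j then
      G.colorAdjMatrix c k else G.normAdjMatrix) (w l.castSucc) (w l.succ) =
      if c s(w i.castSucc, w i.succ) = k then (if c s(w j.castSucc, w j.succ) = k then
        ∏ l : Fin L, G.normAdjMatrix (w l.castSucc) (w l.succ) else 0) else 0 := by
    split_ifs with hi hj
    · refine Finset.prod_congr rfl fun l _ => ?_
      split_ifs with hl
      · rcases hl with hl | hl <;> obtain rfl := Fin.ext hl <;> simp [colorAdjMatrix, hi, hj]
      · rfl
    · exact Finset.prod_eq_zero (Finset.mem_univ j) (by simp [colorAdjMatrix, hj])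
    · exact Finset.prod_eq_zero (Finset.mem_univ i) (by simp [colorAdjMatrix, hi])
  simp only [key, closedWalkWeight]
  by_cases hw : w 0 = w (Fin.last L)
  · simp only [hw, if_true]
    rw [Finset.sum_ite_eq, if_pos (Finset.mem_image_of_mem c (Finset.mem_univ _))]
    simp only [eq_comm]
  · simp [hw]

open Finset in
theorem exists_closed_walk_card_pairs_le {c : Sym2 V → ℕ}
    (hc : ∀ a b b', G.Adj a b → G.Adj a b' → b ≠ b' → c s(a, b) ≠ c s(a, b'))
    {δ : ℝ} (hδ : 0 < δ) (hdeg : ∀ v, G.degree v = 0 ∨ δ ≤ G.degree v) (hG : G ≠ ⊥)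
    {t : ℝ} (ht : 0 < t) {m : ℕ} (hm : (Fintype.card V : ℝ) ≤ t ^ (m + 1)) :
    ∃ w : Fin (2 * (m + 1) + 1) → V, w 0 = w (Fin.last _) ∧
      (∀ i : Fin (2 * (m + 1)), G.Adj (w i.castSucc) (w i.succ)) ∧
      (#{p : Fin (2 * (m + 1)) × Fin (2 * (m + 1)) | p.1 < p.2 ∧
        c s(w p.1.castSucc, w p.1.succ) = c s(w p.2.castSucc, w p.2.succ)} : ℝ) ≤
        (m + 1) * (2 * m + 1) * (δ⁻¹ * t) := by
  have hφ : (fun v => √(G.degree v : ℝ)) ≠ 0 := by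
    obtain ⟨u, v, huv⟩ := SimpleGraph.ne_bot_iff_exists_adj.1 hG
    intro h
    have h1 : 0 < G.degree u := (G.degree_pos_iff_exists_adj u).2 ⟨v, huv⟩
    have h2 : 0 < √(G.degree u : ℝ) := Real.sqrt_pos.2 (by exact_mod_cast h1)
    exact h2.ne' (congrFun h u)
  obtain ⟨hT, hle⟩ := Matrix.trace_pow_le_mul_trace_pow G.isSymm_normAdjMatrix _ hφ
    G.normAdjMatrix_mulVec_sqrt_degree ht hm
  set L := 2 * (m + 1) with hL
  set T := (G.normAdjMatrix ^ L).trace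
  set pairs : (Fin (L + 1) → V) → ℕ := fun w => #{p : Fin L × Fin L | p.1 < p.2 ∧
    c s(w p.1.castSucc, w p.1.succ) = c s(w p.2.castSucc, w p.2.succ)}
  have hpair (p : Fin L × Fin L) (hp : p.1 < p.2) :
      ∑ w : Fin (L + 1) → V, (if c s(w p.1.castSucc, w p.1.succ) =
        c s(w p.2.castSucc, w p.2.succ) then G.closedWalkWeight w else 0) ≤ δ⁻¹ * t * T := by
    rw [sum_closedWalkWeight_eq_color]
    refine (Finset.sum_le_sum fun k _ => Matrix.trace_seqProd_two_factors_le
      G.isSymm_normAdjMatrix (G.isSymm_colorAdjMatrix c k) hp p.2.isLt).trans ?_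
    refine (G.sum_trace_colorAdjMatrix_le hc hδ hdeg _).trans ?_
    rw [mul_assoc]
    gcongr
  have hcard : (#{p : Fin L × Fin L | p.1 < p.2} : ℝ) = (m + 1) * (2 * m + 1) := by
    have := Fin.card_pairs_lt_mul_two L
    rw [show L - 1 = 2 * m + 1 by omega] at this
    have h' : (#{p : Fin L × Fin L | p.1 < p.2} : ℝ) * 2 = (2 * (m + 1)) * (2 * m + 1) := by
      exact_mod_cast this
    linarith
  have hsum : ∑ w : Fin (L + 1) → V, G.closedWalkWeight w * pairs w ≤
      (m + 1) * (2 * m + 1) * (δ⁻¹ * t) * T := by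
    calc ∑ w : Fin (L + 1) → V, G.closedWalkWeight w * pairs w
        = ∑ p : Fin L × Fin L with p.1 < p.2, ∑ w : Fin (L + 1) → V,
          (if c s(w p.1.castSucc, w p.1.succ) = c s(w p.2.castSucc, w p.2.succ) then
            G.closedWalkWeight w else 0) := by
          rw [Finset.sum_comm]
          refine Finset.sum_congr rfl fun w _ => ?_
          rw [← Finset.sum_filter, Finset.filter_filter, Finset.sum_const, nsmul_eq_mul, mul_comm]
      _ ≤ ∑ p : Fin L × Fin L with p.1 < p.2, δ⁻¹ * t * T :=
          Finset.sum_le_sum fun p hp => hpair p (by simpa using hp)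
      _ = _ := by rw [Finset.sum_const, nsmul_eq_mul, hcard]; ring
  obtain ⟨w, hw, hwp⟩ : ∃ w : Fin (L + 1) → V, 0 < G.closedWalkWeight w ∧
      (pairs w : ℝ) ≤ (m + 1) * (2 * m + 1) * (δ⁻¹ * t) := by
    by_contra! h
    refine hsum.not_gt ?_
    have hTs := G.sum_closedWalkWeight L
    rw [show T = _ from hTs.symm, Finset.mul_sum]
    obtain ⟨w, hw0, hw⟩ := Finset.exists_lt_of_sum_lt (s := Finset.univ) (f := fun _ => (0 : ℝ))
      (g := fun w : Fin (L + 1) → V => G.closedWalkWeight w) (by simpa [hTs] using hT)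
    refine Finset.sum_lt_sum (fun w _ => ?_) ⟨w, hw0, ?_⟩
    · rcases (G.closedWalkWeight_nonneg w).eq_or_lt with h0 | h0
      · simp [← h0]
      · rw [mul_comm]
        exact mul_le_mul_of_nonneg_left (h w h0).le h0.le
    · rw [mul_comm]
      exact mul_lt_mul_of_pos_left (h w hw) hw
  rw [closedWalkWeight] at hw
  split_ifs at hw with hcl
  · refine ⟨w, hcl, fun i => ?_, hwp⟩
    by_contra hadj
    refine hw.ne' (Finset.prod_eq_zero (Finset.mem_univ i) ?_)
    simp [normAdjMatrix, hadj]
  · exact absurd hw (lt_irrefl _)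

end SimpleGraph

/-- For every `0 < ε < 1/2` and all sufficiently large `n`, every properly
edge-colored graph on `n` vertices with at least `(4/ε) n log n` edges contains a cycle of
some length `k` whose edges receive more than `(1 - ε) k` distinct colors. -/
theorem almost_rainbow_cycle (ε : ℝ) (hε : 0 < ε) (hε' : ε < 1 / 2) :
    ∃ n₀ : ℕ, ∀ n : ℕ, n₀ ≤ n →
      ∀ (G : SimpleGraph (Fin n)) (c : Sym2 (Fin n) → ℕ),
        (∀ a b b' : Fin n, G.Adj a b → G.Adj a b' → b ≠ b' → c s(a, b) ≠ c s(a, b')) →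
        (4 / ε) * (n : ℝ) * Real.log n ≤ (G.edgeSet.ncard : ℝ) →
        ∃ (v : Fin n) (w : G.Walk v v), w.IsCycle ∧
          (1 - ε) * (w.length : ℝ) < ((w.edges.map c).toFinset.card : ℝ) := by
  classical
  refine ⟨8, fun n hn G c hc hG => ?_⟩
  have hn' : (8 : ℝ) ≤ n := by exact_mod_cast hn
  have he : Real.exp 1 < 2.72 := Real.exp_one_lt_d9.trans (by norm_num)
  have hlog : 2 ≤ Real.log n := by
    rw [Real.le_log_iff_exp_le (by linarith), show (2 : ℝ) = 1 + 1 by norm_num, Real.exp_add]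
    nlinarith [Real.exp_pos 1]
  set δ : ℝ := 4 / ε * Real.log n with hδ_def
  have hδ : 0 < δ := by positivity
  have hδε : δ * ε = 4 * Real.log n := by rw [hδ_def]; field_simp
  have hG' : δ * (Finset.univ : Finset (Fin n)).card ≤ G.edgeSet.ncard := by
    rw [Finset.card_univ, Fintype.card_fin, hδ_def]
    linarith
  have hpos : 0 < G.edgeSet.ncard := by
    have : 0 < δ * (Finset.univ : Finset (Fin n)).card := by
      rw [Finset.card_univ, Fintype.card_fin]
      positivity
    exact_mod_cast this.trans_le hG'
  obtain ⟨H, hHG, hHpos, hdeg⟩ := SimpleGraph.exists_le_forall_degree_eq_zero_or_le hδ.le _ G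
    (fun a _ _ => Finset.mem_univ a) hpos hG'
  have hH : H ≠ ⊥ := by
    rintro rfl
    simp at hHpos
  set m := ⌈Real.log n⌉₊ - 1 with hm_def
  have hceil : ⌈Real.log n⌉₊ = m + 1 := by
    have : 0 < ⌈Real.log n⌉₊ := Nat.ceil_pos.2 (by linarith)
    omega
  have hm_ge : Real.log n ≤ m + 1 := by
    have := Nat.le_ceil (Real.log n)
    rw [hceil] at this
    exact_mod_cast this
  have hm_lt : (m : ℝ) < Real.log n := by
    have := Nat.ceil_lt_add_one (show 0 ≤ Real.log n by linarith)
    rw [hceil] at this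
    push_cast at this
    linarith
  have hcard : (Fintype.card (Fin n) : ℝ) ≤ Real.exp 1 ^ (m + 1) := by
    rw [Fintype.card_fin, ← Real.exp_nat_mul, mul_one, ← Real.log_le_iff_le_exp (by linarith)]
    exact_mod_cast hm_ge
  obtain ⟨w, hw, hadj, hpairs⟩ := H.exists_closed_walk_card_pairs_le
    (fun a b b' h h' => hc a b b' (hHG h) (hHG h')) hδ hdeg hH (Real.exp_pos 1) hcard
  obtain ⟨p, hp⟩ := SimpleGraph.exists_walk_edges_eq_ofFn w fun i => hHG (hadj i)
  have hpl : p.length = 2 * (m + 1) := by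
    rw [← SimpleGraph.Walk.length_edges, hp, List.length_ofFn]
  have hcol := Fin.le_card_image_add_card_pairs fun i : Fin (2 * (m + 1)) =>
    c s(w i.castSucc, w i.succ)
  have himg : (p.edges.map c).toFinset = Finset.univ.image fun i : Fin (2 * (m + 1)) =>
      c s(w i.castSucc, w i.succ) := by
    ext x
    simp only [hp, List.map_ofFn, List.mem_toFinset, List.mem_ofFn, Finset.mem_image,
      Finset.mem_univ, true_and, Function.comp_apply]
  rw [← himg] at hcol
  have hcol' : (2 * (m + 1) : ℝ) ≤ (p.edges.map c).toFinset.card +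
      Finset.card {q : Fin (2 * (m + 1)) × Fin (2 * (m + 1)) | q.1 < q.2 ∧
        c s(w q.1.castSucc, w q.1.succ) = c s(w q.2.castSucc, w q.2.succ)} := by
    exact_mod_cast hcol
  have hbound : (m + 1) * (2 * m + 1) * (δ⁻¹ * Real.exp 1) < ε * (2 * (m + 1)) := by
    have h1 : (2 * m + 1) * Real.exp 1 < 2 * (δ * ε) := by
      rw [hδε]
      nlinarith [Real.exp_pos 1]
    have h2 : (2 * m + 1) * (δ⁻¹ * Real.exp 1) < 2 * ε := by
      rw [← mul_assoc, mul_right_comm, ← div_eq_mul_inv, div_lt_iff₀ hδ]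
      linarith
    have h3 : (0 : ℝ) < m + 1 := by positivity
    nlinarith
  refine SimpleGraph.Walk.exists_isCycle_lt_card_colors (r := 1 - ε) (by linarith)
    (p.copy rfl hw.symm) ?_
  rw [SimpleGraph.Walk.length_copy, SimpleGraph.Walk.edges_copy, hpl]
  push_cast
  linarith
end

section
/- There exists a constant C > 0 such that for all n ≥ 3, every properly edge-colored graph on n vertices with average degree at least C·log(n)·log(log(n)) (equivalently, with at least (C/2)·n·log(n)·log(log(n)) edges) contains a rainbow cycle. -/
/-- The expectation of `Φ A`, where `A` is a random subset of `S` containing each element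
independently with probability `p`. -/
noncomputable def bernoulliMean {ι : Type*} [DecidableEq ι] (S : Finset ι) (p : ℝ)
    (Φ : Finset ι → ℝ) : ℝ :=
  ∑ A ∈ S.powerset, p ^ A.card * (1 - p) ^ (S \ A).card * Φ A

section BernoulliMean

variable {ι : Type*} [DecidableEq ι]

theorem bernoulliMean_insert {S : Finset ι} {a : ι} (ha : a ∉ S) (p : ℝ) (Φ : Finset ι → ℝ) :
    bernoulliMean (insert a S) p Φ =
      p * bernoulliMean S p (fun A => Φ (insert a A)) + (1 - p) * bernoulliMean S p Φ := by
  unfold bernoulliMean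
  rw [Finset.sum_powerset_insert ha, add_comm, Finset.mul_sum, Finset.mul_sum]
  congr 1
  · refine Finset.sum_congr rfl fun A hA => ?_
    have haA : a ∉ A := fun h => ha (Finset.mem_powerset.1 hA h)
    rw [Finset.card_insert_of_notMem haA, Finset.insert_sdiff_insert,
      Finset.sdiff_insert_of_notMem ha, pow_succ]
    ring
  · refine Finset.sum_congr rfl fun A hA => ?_
    have haA : a ∉ A := fun h => ha (Finset.mem_powerset.1 hA h)
    rw [Finset.insert_sdiff_of_notMem _ haA, Finset.card_insert_of_notMem (by simp [ha]), pow_succ]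
    ring

theorem bernoulliMean_add (S : Finset ι) (p : ℝ) (Φ Ψ : Finset ι → ℝ) :
    bernoulliMean S p (fun A => Φ A + Ψ A) = bernoulliMean S p Φ + bernoulliMean S p Ψ := by
  simp [bernoulliMean, mul_add, Finset.sum_add_distrib]

theorem bernoulliMean_const_mul (S : Finset ι) (p a : ℝ) (Φ : Finset ι → ℝ) :
    bernoulliMean S p (fun A => a * Φ A) = a * bernoulliMean S p Φ := by
  simp only [bernoulliMean, Finset.mul_sum]
  exact Finset.sum_congr rfl fun A _ => by ring

theorem bernoulliMean_const (S : Finset ι) (p a : ℝ) :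
    bernoulliMean S p (fun _ => a) = a := by
  induction S using Finset.induction_on with
  | empty => simp [bernoulliMean]
  | insert b S hb ih => rw [bernoulliMean_insert hb, ih]; ring

theorem bernoulliMean_mono {S : Finset ι} {p : ℝ} (hp₀ : 0 ≤ p) (hp₁ : p ≤ 1)
    {Φ Ψ : Finset ι → ℝ} (h : ∀ A ⊆ S, Φ A ≤ Ψ A) :
    bernoulliMean S p Φ ≤ bernoulliMean S p Ψ := by
  refine Finset.sum_le_sum fun A hA => mul_le_mul_of_nonneg_left (h A (Finset.mem_powerset.1 hA)) ?_
  have : 0 ≤ 1 - p := by linarith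
  positivity

theorem bernoulliMean_compl_half (S : Finset ι) (Φ : Finset ι → ℝ) :
    bernoulliMean S (1 / 2) (fun A => Φ (S \ A)) = bernoulliMean S (1 / 2) Φ := by
  unfold bernoulliMean
  refine Finset.sum_nbij' (fun A => S \ A) (fun A => S \ A) ?_ ?_ ?_ ?_ ?_
  · simp
  · simp
  · intro A hA
    simpa using Finset.mem_powerset.1 hA
  · intro A hA
    simpa using Finset.mem_powerset.1 hA
  · intro A hA
    rw [Finset.sdiff_sdiff_eq_self (Finset.mem_powerset.1 hA)]
    norm_num
    left
    ring

/-- Russo's formula. -/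
theorem hasDerivAt_bernoulliMean (S : Finset ι) (p : ℝ) (Φ : Finset ι → ℝ) :
    HasDerivAt (fun q => bernoulliMean S q Φ)
      (bernoulliMean S p fun A => ∑ a ∈ S, (Φ (insert a A) - Φ (A.erase a))) p := by
  induction S using Finset.induction_on generalizing Φ with
  | empty => simpa [bernoulliMean] using hasDerivAt_const p _
  | insert b S hb ih =>
    simp only [bernoulliMean_insert hb]
    have h₁ := (hasDerivAt_id p).mul (ih fun A => Φ (insert b A))
    have h₂ := ((hasDerivAt_id p).const_sub 1).mul (ih Φ)
    refine (h₁.add h₂).congr_deriv ?_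
    have key : ∀ A ⊆ S, (∑ a ∈ S, (Φ (insert a (insert b A)) - Φ ((insert b A).erase a))) =
        ∑ a ∈ S, (Φ (insert b (insert a A)) - Φ (insert b (A.erase a))) := by
      intro A _
      refine Finset.sum_congr rfl fun a ha => ?_
      have hab : a ≠ b := fun h => hb (h ▸ ha)
      rw [Finset.insert_comm, Finset.erase_insert_of_ne hab.symm]
    have e₁ : bernoulliMean S p (fun A => ∑ a ∈ insert b S,
        (Φ (insert a (insert b A)) - Φ ((insert b A).erase a))) =
        bernoulliMean S p (fun A => Φ (insert b A)) + (-1) * bernoulliMean S p Φ +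
        bernoulliMean S p
          (fun A => ∑ a ∈ S, (Φ (insert b (insert a A)) - Φ (insert b (A.erase a)))) := by
      rw [← bernoulliMean_const_mul, ← bernoulliMean_add, ← bernoulliMean_add]
      refine Finset.sum_congr rfl fun A hA => ?_
      have hbA : b ∉ A := fun h => hb (Finset.mem_powerset.1 hA h)
      dsimp only
      rw [Finset.sum_insert hb, key A (Finset.mem_powerset.1 hA), Finset.insert_idem,
        Finset.erase_insert hbA]
      ring
    have e₂ : bernoulliMean S p (fun A => ∑ a ∈ insert b S, (Φ (insert a A) - Φ (A.erase a))) =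
        bernoulliMean S p (fun A => Φ (insert b A)) + (-1) * bernoulliMean S p Φ +
        bernoulliMean S p (fun A => ∑ a ∈ S, (Φ (insert a A) - Φ (A.erase a))) := by
      rw [← bernoulliMean_const_mul, ← bernoulliMean_add, ← bernoulliMean_add]
      refine Finset.sum_congr rfl fun A hA => ?_
      have hbA : b ∉ A := fun h => hb (Finset.mem_powerset.1 hA h)
      dsimp only
      rw [Finset.sum_insert hb, Finset.erase_eq_of_notMem hbA]
      ring
    rw [e₁, e₂]
    simp only [id_eq]
    ring

/-- If the total influence of `Φ` dominates a multiple of `Φ` with a negative sign, then the mean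
of `Φ` decays exponentially. -/
theorem bernoulliMean_half_le {S : Finset ι} {Φ : Finset ι → ℝ} {K L : ℝ}
    (hL : ∀ A ⊆ S, Φ A ≤ L)
    (h : ∀ A ⊆ S, K * Φ A ≤ -∑ a ∈ S, (Φ (insert a A) - Φ (A.erase a))) :
    bernoulliMean S (1 / 2) Φ ≤ L * Real.exp (-(K / 2)) := by
  have hd : ∀ q, HasDerivAt (fun q => bernoulliMean S q Φ * Real.exp (K * q))
      ((bernoulliMean S q fun A => ∑ a ∈ S, (Φ (insert a A) - Φ (A.erase a))) * Real.exp (K * q) +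
        bernoulliMean S q Φ * (Real.exp (K * q) * K)) q := fun q =>
    (hasDerivAt_bernoulliMean S q Φ).mul
      (by simpa using ((hasDerivAt_id q).const_mul K).exp)
  have hanti : AntitoneOn (fun q => bernoulliMean S q Φ * Real.exp (K * q)) (Set.Icc 0 1) := by
    refine antitoneOn_of_deriv_nonpos (convex_Icc 0 1)
      (fun q _ => (hd q).continuousAt.continuousWithinAt)
      (fun q _ => (hd q).differentiableAt.differentiableWithinAt) fun q hq => ?_
    rw [interior_Icc] at hq
    rw [(hd q).deriv]
    have := bernoulliMean_mono hq.1.le hq.2.le h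
    have e : bernoulliMean S q (fun A => -∑ a ∈ S, (Φ (insert a A) - Φ (A.erase a))) =
        -bernoulliMean S q (fun A => ∑ a ∈ S, (Φ (insert a A) - Φ (A.erase a))) := by
      simp only [bernoulliMean, mul_neg, Finset.sum_neg_distrib]
    rw [bernoulliMean_const_mul, e] at this
    have hexp := Real.exp_pos (K * q)
    nlinarith
  have h₁ := hanti (a := 0) (b := 1 / 2) (by norm_num) (by norm_num) (by norm_num)
  have h₀ : bernoulliMean S 0 Φ ≤ L :=
    (bernoulliMean_mono le_rfl zero_le_one hL).trans_eq (bernoulliMean_const S 0 L)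
  simp only [mul_zero, Real.exp_zero, mul_one] at h₁
  rw [Real.exp_neg, ← div_eq_mul_inv, le_div_iff₀ (Real.exp_pos _)]
  calc _ = bernoulliMean S (1 / 2) Φ * Real.exp (K * (1 / 2)) := by ring_nf
    _ ≤ L := h₁.trans h₀

/-- If the mean of `Φ` is small, then some set and its complement both have small `Φ`. -/
theorem exists_add_compl_lt {S : Finset ι} {Φ : Finset ι → ℝ} {ε : ℝ}
    (h : bernoulliMean S (1 / 2) Φ < ε) : ∃ A ⊆ S, Φ A + Φ (S \ A) < 2 * ε := by
  by_contra! hcon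
  have := bernoulliMean_mono (S := S) (p := 1 / 2) (by norm_num) (by norm_num) hcon
  rw [bernoulliMean_const, bernoulliMean_add, bernoulliMean_compl_half] at this
  linarith

end BernoulliMean

section RainbowReach

variable {V : Type*} (G : SimpleGraph V) (c : Sym2 V → ℕ)

open Classical in
/-- The pairs `(u, w) ∈ U × T` that are edges. -/
noncomputable def cut (U T : Finset V) : Finset (V × V) :=
  (U ×ˢ T).filter fun e => G.Adj e.1 e.2

open Classical in
/-- The pairs `(u, w) ∈ U × T` that are edges of colour `k`. -/
noncomputable def colorCut (U T : Finset V) (k : ℕ) : Finset (V × V) :=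
  (cut G U T).filter fun e => c s(e.1, e.2) = k

open Classical in
/-- The vertices of `W` that can be reached from `v` by a rainbow walk with colours in `A`. -/
noncomputable def rainbowReach (W : Finset V) (v : V) (A : Finset ℕ) : Finset V :=
  W.filter fun w => ∃ p : G.Walk v w, (p.edges.map c).Nodup ∧ ∀ e ∈ p.edges, c e ∈ A

variable {G c}

theorem mem_cut {U T : Finset V} {e : V × V} :
    e ∈ cut G U T ↔ (e.1 ∈ U ∧ e.2 ∈ T) ∧ G.Adj e.1 e.2 := by
  simp [cut]

theorem mem_colorCut {U T : Finset V} {k : ℕ} {e : V × V} :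
    e ∈ colorCut G c U T k ↔ ((e.1 ∈ U ∧ e.2 ∈ T) ∧ G.Adj e.1 e.2) ∧ c s(e.1, e.2) = k := by
  simp [colorCut, mem_cut]

theorem mem_rainbowReach {W : Finset V} {v w : V} {A : Finset ℕ} :
    w ∈ rainbowReach G c W v A ↔
      w ∈ W ∧ ∃ p : G.Walk v w, (p.edges.map c).Nodup ∧ ∀ e ∈ p.edges, c e ∈ A := by
  simp [rainbowReach]

theorem rainbowReach_subset (W : Finset V) (v : V) (A : Finset ℕ) :
    rainbowReach G c W v A ⊆ W := fun _ h => (mem_rainbowReach.1 h).1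

theorem mem_rainbowReach_self {W : Finset V} {v : V} (hv : v ∈ W) (A : Finset ℕ) :
    v ∈ rainbowReach G c W v A :=
  mem_rainbowReach.2 ⟨hv, .nil, by simp, by simp⟩

theorem card_rainbowReach_pos {W : Finset V} {v : V} (hv : v ∈ W) (A : Finset ℕ) :
    0 < (rainbowReach G c W v A).card :=
  Finset.card_pos.2 ⟨v, mem_rainbowReach_self hv A⟩

theorem rainbowReach_mono (W : Finset V) (v : V) {A B : Finset ℕ} (h : A ⊆ B) :
    rainbowReach G c W v A ⊆ rainbowReach G c W v B := by
  intro w hw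
  obtain ⟨hwW, p, hp, hpA⟩ := mem_rainbowReach.1 hw
  exact mem_rainbowReach.2 ⟨hwW, p, hp, fun e he => h (hpA e he)⟩

theorem mem_rainbowReach_insert {W : Finset V} {v u w : V} {A : Finset ℕ}
    (hu : u ∈ rainbowReach G c W v A) (hw : w ∈ W) (huw : G.Adj u w) (hA : c s(u, w) ∉ A) :
    w ∈ rainbowReach G c W v (insert (c s(u, w)) A) := by
  obtain ⟨-, p, hp, hpA⟩ := mem_rainbowReach.1 hu
  refine mem_rainbowReach.2 ⟨hw, p.concat huw, ?_, ?_⟩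
  · rw [SimpleGraph.Walk.edges_concat, List.concat_eq_append, List.map_append, List.nodup_append]
    refine ⟨hp, by simp, ?_⟩
    rintro a ha b hb rfl
    obtain ⟨e, he, rfl⟩ := List.mem_map.1 ha
    simp only [List.map_cons, List.map_nil, List.mem_singleton] at hb
    exact hA (hb ▸ hpA e he)
  · intro e he
    rw [SimpleGraph.Walk.edges_concat, List.concat_eq_append, List.mem_append] at he
    rcases he with he | he
    · exact Finset.mem_insert_of_mem (hpA e he)
    · rw [List.mem_singleton.1 he]
      exact Finset.mem_insert_self _ _

theorem injOn_fst_colorCut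
    (hc : ∀ a b b' : V, G.Adj a b → G.Adj a b' → b ≠ b' → c s(a, b) ≠ c s(a, b'))
    (U T : Finset V) (k : ℕ) : Set.InjOn Prod.fst (colorCut G c U T k : Set (V × V)) := by
  rintro ⟨u, w⟩ h ⟨u', w'⟩ h' (rfl : u = u')
  obtain ⟨⟨-, ha⟩, hk⟩ := mem_colorCut.1 h
  obtain ⟨⟨-, ha'⟩, hk'⟩ := mem_colorCut.1 h'
  by_contra hne
  exact hc u w w' ha ha' (fun h => hne (by rw [h])) (hk.trans hk'.symm)

theorem injOn_snd_colorCut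
    (hc : ∀ a b b' : V, G.Adj a b → G.Adj a b' → b ≠ b' → c s(a, b) ≠ c s(a, b'))
    (U T : Finset V) (k : ℕ) : Set.InjOn Prod.snd (colorCut G c U T k : Set (V × V)) := by
  rintro ⟨u, w⟩ h ⟨u', w'⟩ h' (rfl : w = w')
  obtain ⟨⟨-, ha⟩, hk⟩ := mem_colorCut.1 h
  obtain ⟨⟨-, ha'⟩, hk'⟩ := mem_colorCut.1 h'
  by_contra hne
  refine hc w u u' ha.symm ha'.symm (fun h => hne (by rw [h])) ?_
  rw [Sym2.eq_swap, Sym2.eq_swap (a := w)]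
  exact hk.trans hk'.symm

theorem card_colorCut_le
    (hc : ∀ a b b' : V, G.Adj a b → G.Adj a b' → b ≠ b' → c s(a, b) ≠ c s(a, b'))
    (U T : Finset V) (k : ℕ) : (colorCut G c U T k).card ≤ U.card :=
  Finset.card_le_card_of_injOn Prod.fst (fun _ he => (mem_colorCut.1 he).1.1.1)
    (injOn_fst_colorCut hc U T k)

theorem ncard_edgeSet_le_card_cut [Fintype V] :
    G.edgeSet.ncard ≤ (cut G Finset.univ Finset.univ).card := by
  have h : G.edgeSet ⊆ (fun e : V × V => s(e.1, e.2)) '' (cut G Finset.univ Finset.univ) := by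
    intro e he
    induction e with
    | _ a b => exact ⟨(a, b), mem_cut.2 ⟨by simp, he⟩, rfl⟩
  refine (Set.ncard_le_ncard h (Set.toFinite _)).trans ?_
  refine (Set.ncard_image_le (Finset.finite_toSet _)).trans_eq ?_
  exact Set.ncard_coe_finset _

theorem card_cut_comm (U T : Finset V) : (cut G U T).card = (cut G T U).card := by
  refine Finset.card_nbij' Prod.swap Prod.swap ?_ ?_ (fun _ _ => rfl) (fun _ _ => rfl) <;>
  · intro e he
    have he := mem_cut.1 he
    exact mem_cut.2 ⟨he.1.symm, he.2.symm⟩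

variable [DecidableEq V]

theorem card_add_card_colorCut_le
    (hc : ∀ a b b' : V, G.Adj a b → G.Adj a b' → b ≠ b' → c s(a, b) ≠ c s(a, b'))
    (W : Finset V) (v : V) {A : Finset ℕ} {k : ℕ} (hk : k ∉ A) :
    (rainbowReach G c W v A).card +
        (colorCut G c (rainbowReach G c W v A) (W \ rainbowReach G c W v A) k).card ≤
      (rainbowReach G c W v (insert k A)).card := by
  have hsub := rainbowReach_mono (G := G) (c := c) W v (Finset.subset_insert k A)
  have : (colorCut G c (rainbowReach G c W v A) (W \ rainbowReach G c W v A) k).card ≤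
      (rainbowReach G c W v (insert k A) \ rainbowReach G c W v A).card := by
    refine Finset.card_le_card_of_injOn Prod.snd (fun e he => ?_) (injOn_snd_colorCut hc _ _ k)
    obtain ⟨⟨⟨h₁, h₂⟩, hadj⟩, rfl⟩ := mem_colorCut.1 he
    rw [Finset.mem_sdiff] at h₂
    exact Finset.mem_sdiff.2 ⟨mem_rainbowReach_insert h₁ h₂.1 hadj hk, h₂.2⟩
  have := Finset.card_sdiff_add_card_eq_card hsub
  omega

theorem card_colorCut_add_two_mul_le
    (hc : ∀ a b b' : V, G.Adj a b → G.Adj a b' → b ≠ b' → c s(a, b) ≠ c s(a, b'))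
    (W : Finset V) (v : V) {A : Finset ℕ} {k : ℕ} (hk : k ∈ A) :
    (colorCut G c (rainbowReach G c W v A) (W \ rainbowReach G c W v A) k).card +
        2 * (rainbowReach G c W v (A.erase k)).card ≤ 2 * (rainbowReach G c W v A).card := by
  have hsub := rainbowReach_mono (G := G) (c := c) W v (Finset.erase_subset k A)
  have h₁ := card_add_card_colorCut_le hc W v (Finset.notMem_erase k A)
  rw [Finset.insert_erase hk] at h₁
  set U := rainbowReach G c W v A
  set U' := rainbowReach G c W v (A.erase k)
  have h₂ : colorCut G c U (W \ U) k ⊆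
      colorCut G c U' (W \ U') k ∪ colorCut G c (U \ U') (W \ U) k := by
    intro e he
    obtain ⟨⟨⟨hu, hw⟩, hadj⟩, hek⟩ := mem_colorCut.1 he
    by_cases hu' : e.1 ∈ U'
    · refine Finset.mem_union_left _ (mem_colorCut.2 ⟨⟨⟨hu', ?_⟩, hadj⟩, hek⟩)
      exact Finset.sdiff_subset_sdiff le_rfl hsub hw
    · exact Finset.mem_union_right _
        (mem_colorCut.2 ⟨⟨⟨Finset.mem_sdiff.2 ⟨hu, hu'⟩, hw⟩, hadj⟩, hek⟩)
  have h₃ := (Finset.card_le_card h₂).trans (Finset.card_union_le _ _)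
  have h₄ := card_colorCut_le hc (U \ U') (W \ U) k
  have h₅ := Finset.card_sdiff_add_card_eq_card hsub
  omega

theorem card_colorCut_div_le
    (hc : ∀ a b b' : V, G.Adj a b → G.Adj a b' → b ≠ b' → c s(a, b) ≠ c s(a, b'))
    {W : Finset V} {v : V} (hv : v ∈ W) (A : Finset ℕ) (k : ℕ) :
    ((colorCut G c (rainbowReach G c W v A) (W \ rainbowReach G c W v A) k).card : ℝ) /
        (rainbowReach G c W v A).card ≤
      2 * (Real.log (rainbowReach G c W v (insert k A)).card -
        Real.log (rainbowReach G c W v (A.erase k)).card) := by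
  have hX : (0 : ℝ) < (rainbowReach G c W v (insert k A)).card :=
    mod_cast card_rainbowReach_pos hv _
  have hY : (0 : ℝ) < (rainbowReach G c W v (A.erase k)).card :=
    mod_cast card_rainbowReach_pos hv _
  rw [← Real.log_div hX.ne' hY.ne']
  have hlog := Real.one_sub_inv_le_log_of_pos (div_pos hX hY)
  rw [inv_div] at hlog
  refine le_trans ?_ (mul_le_mul_of_nonneg_left hlog zero_le_two)
  by_cases hk : k ∈ A
  · have h : ((colorCut G c (rainbowReach G c W v A) (W \ rainbowReach G c W v A) k).card : ℝ) +
        2 * (rainbowReach G c W v (A.erase k)).card ≤ 2 * (rainbowReach G c W v A).card :=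
      mod_cast card_colorCut_add_two_mul_le hc W v hk
    rw [Finset.insert_eq_of_mem hk] at hX ⊢
    rw [div_le_iff₀ hX, mul_assoc, sub_mul, div_mul_cancel₀ _ hX.ne']
    linarith
  · have h : ((rainbowReach G c W v A).card : ℝ) +
        (colorCut G c (rainbowReach G c W v A) (W \ rainbowReach G c W v A) k).card ≤
        (rainbowReach G c W v (insert k A)).card :=
      mod_cast card_add_card_colorCut_le hc W v hk
    have h' : ((colorCut G c (rainbowReach G c W v A) (W \ rainbowReach G c W v A) k).card : ℝ) ≤
        (rainbowReach G c W v A).card := mod_cast card_colorCut_le hc _ _ k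
    rw [Finset.erase_eq_of_notMem hk] at hY ⊢
    set B : ℝ := ((colorCut G c (rainbowReach G c W v A) (W \ rainbowReach G c W v A) k).card : ℝ)
    have hB : 0 ≤ B := Nat.cast_nonneg _
    set X : ℝ := ((rainbowReach G c W v (insert k A)).card : ℝ)
    set Y : ℝ := ((rainbowReach G c W v A).card : ℝ)
    rw [one_sub_div hX.ne', ← mul_div_assoc, div_le_div_iff₀ hY hX]
    nlinarith [mul_nonneg hB (sub_nonneg.2 h'), mul_nonneg (sub_nonneg.2 h') (sub_nonneg.2 h)]

theorem card_cut_div_le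
    (hc : ∀ a b b' : V, G.Adj a b → G.Adj a b' → b ≠ b' → c s(a, b) ≠ c s(a, b'))
    {S : Finset ℕ} (hS : ∀ e ∈ G.edgeSet, c e ∈ S) {W : Finset V} {v : V} (hv : v ∈ W)
    (A : Finset ℕ) :
    ((cut G (rainbowReach G c W v A) (W \ rainbowReach G c W v A)).card : ℝ) /
        (rainbowReach G c W v A).card ≤
      2 * ∑ k ∈ S, (Real.log (rainbowReach G c W v (insert k A)).card -
        Real.log (rainbowReach G c W v (A.erase k)).card) := by
  have h : (cut G (rainbowReach G c W v A) (W \ rainbowReach G c W v A)).card =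
      ∑ k ∈ S, (colorCut G c (rainbowReach G c W v A) (W \ rainbowReach G c W v A) k).card := by
    rw [Finset.card_eq_sum_card_fiberwise (f := fun e => c s(e.1, e.2)) (t := S)]
    · refine Finset.sum_congr rfl fun k _ => congrArg _ ?_
      ext e
      simp [mem_cut, mem_colorCut]
    · exact fun e he => hS _ (mem_cut.1 he).2
  rw [h, Nat.cast_sum, Finset.sum_div, Finset.mul_sum]
  exact Finset.sum_le_sum fun k _ => card_colorCut_div_le hc hv A k

theorem exists_rainbow_cycle_of_walks {S A : Finset ℕ} {v w : V} (hvw : v ≠ w)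
    {p q : G.Walk v w} (hp : (p.edges.map c).Nodup) (hpA : ∀ e ∈ p.edges, c e ∈ A)
    (hq : (q.edges.map c).Nodup) (hqA : ∀ e ∈ q.edges, c e ∈ S \ A) :
    ∃ (x : V) (r : G.Walk x x), r.IsCycle ∧ (r.edges.map c).Nodup := by
  set H : SimpleGraph V := .fromEdgeSet {e | e ∈ p.edges ∨ e ∈ q.edges} with hH
  have hmem : ∀ e ∈ H.edgeSet, e ∈ p.edges ∨ e ∈ q.edges := by
    intro e he
    rw [hH, SimpleGraph.edgeSet_fromEdgeSet] at he
    exact he.1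
  have hpH : ∀ e ∈ p.edges, e ∈ H.edgeSet := by
    intro e he
    rw [hH, SimpleGraph.edgeSet_fromEdgeSet]
    exact ⟨.inl he, G.not_isDiag_of_mem_edgeSet (p.edges_subset_edgeSet he)⟩
  have hqH : ∀ e ∈ q.edges, e ∈ H.edgeSet := by
    intro e he
    rw [hH, SimpleGraph.edgeSet_fromEdgeSet]
    exact ⟨.inr he, G.not_isDiag_of_mem_edgeSet (q.edges_subset_edgeSet he)⟩
  have hHG : H ≤ G := by
    rw [← SimpleGraph.edgeSet_subset_edgeSet]
    exact fun e he => (hmem e he).elim (p.edges_subset_edgeSet ·) (q.edges_subset_edgeSet ·)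
  have hinj : ∀ e ∈ H.edgeSet, ∀ f ∈ H.edgeSet, c e = c f → e = f := by
    intro e he f hf hef
    rcases hmem e he with he | he <;> rcases hmem f hf with hf | hf
    · exact List.inj_on_of_nodup_map hp he hf hef
    · exact absurd (hef ▸ hpA e he) (Finset.mem_sdiff.1 (hqA f hf)).2
    · exact absurd (hef ▸ hpA f hf) (Finset.mem_sdiff.1 (hqA e he)).2
    · exact List.inj_on_of_nodup_map hq he hf hef
  have hcyc : ¬ H.IsAcyclic := by
    intro hac
    have := hac.subsingleton_path v w
    have heq := Subsingleton.elim (p.transfer H hpH).toPath (q.transfer H hqH).toPath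
    have hne : ((p.transfer H hpH).toPath : H.Walk v w).edges ≠ [] := by
      intro h
      rw [SimpleGraph.Walk.edges_eq_nil] at h
      exact hvw h.eq
    obtain ⟨e, he⟩ := List.exists_mem_of_ne_nil _ hne
    have h₁ := SimpleGraph.Walk.edges_toPath_subset_edges _ he
    rw [heq] at he
    have h₂ := SimpleGraph.Walk.edges_toPath_subset_edges _ he
    rw [SimpleGraph.Walk.edges_transfer] at h₁ h₂
    exact (Finset.mem_sdiff.1 (hqA e h₂)).2 (hpA e h₁)
  simp only [SimpleGraph.IsAcyclic, not_forall, not_not] at hcyc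
  obtain ⟨x, r, hr⟩ := hcyc
  refine ⟨x, r.mapLe hHG, hr.mapLe hHG, ?_⟩
  rw [SimpleGraph.Walk.edges_mapLe_eq_edges]
  exact hr.edges_nodup.map_on fun e he f hf =>
    hinj e (r.edges_subset_edgeSet he) f (r.edges_subset_edgeSet hf)

/-- A properly coloured graph with logarithmic edge expansion on `W` has a rainbow cycle. -/
theorem exists_rainbow_cycle_of_expansion
    (hc : ∀ a b b' : V, G.Adj a b → G.Adj a b' → b ≠ b' → c s(a, b) ≠ c s(a, b'))
    {S : Finset ℕ} (hS : ∀ e ∈ G.edgeSet, c e ∈ S) {W : Finset V} (hW : 2 ≤ W.card) {K : ℝ}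
    (hK : ∀ U ⊆ W, U.Nonempty →
      K * U.card * (Real.log W.card - Real.log U.card) ≤ (cut G U (W \ U)).card)
    (hlog : Real.log W.card * Real.exp (-(K / 4)) < 1 / 8) :
    ∃ (x : V) (r : G.Walk x x), r.IsCycle ∧ (r.edges.map c).Nodup := by
  obtain ⟨v, hv⟩ : W.Nonempty := Finset.card_pos.1 (by omega)
  set R := rainbowReach G c W v with hR
  have hRpos : ∀ A, (0 : ℝ) < (R A).card := fun A => mod_cast card_rainbowReach_pos hv A
  have hWpos : (0 : ℝ) < W.card := by exact_mod_cast (by omega : 0 < W.card)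
  have hmean : bernoulliMean S (1 / 2) (fun A => Real.log W.card - Real.log (R A).card) < 1 / 8 := by
    refine lt_of_le_of_lt (bernoulliMean_half_le (K := K / 2) (L := Real.log W.card) ?_ ?_) ?_
    · intro A _
      have : (1 : ℝ) ≤ (R A).card := mod_cast card_rainbowReach_pos hv A
      linarith [Real.log_nonneg this]
    · intro A _
      have h₁ := hK (R A) (rainbowReach_subset W v A) ⟨v, mem_rainbowReach_self hv A⟩
      have h₂ := card_cut_div_le hc hS hv A
      rw [← hR, div_le_iff₀ (hRpos A)] at h₂
      have h₃ := h₁.trans h₂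
      have h₄ : K * (Real.log W.card - Real.log (R A).card) ≤
          2 * ∑ k ∈ S, (Real.log (R (insert k A)).card - Real.log (R (A.erase k)).card) :=
        le_of_mul_le_mul_right (by linarith) (hRpos A)
      rw [← Finset.sum_neg_distrib]
      have h₅ : ∑ k ∈ S, -(Real.log W.card - Real.log (R (insert k A)).card -
          (Real.log W.card - Real.log (R (A.erase k)).card)) =
          ∑ k ∈ S, (Real.log (R (insert k A)).card - Real.log (R (A.erase k)).card) :=
        Finset.sum_congr rfl fun k _ => by ring
      rw [h₅]
      linarith
    · rwa [div_div, show (2 : ℝ) * 2 = 4 by norm_num]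
  obtain ⟨A, -, hA⟩ := exists_add_compl_lt hmean
  have hle : ∀ B, (R B).card ≤ W.card := fun B => Finset.card_le_card (rainbowReach_subset W v B)
  have hlarge : ∀ B, Real.log W.card - Real.log (R B).card < 1 / 4 →
      3 * (W.card : ℝ) < 4 * (R B).card := by
    intro B hB
    rw [← Real.log_div hWpos.ne' (hRpos B).ne'] at hB
    have := (Real.one_sub_inv_le_log_of_pos (div_pos hWpos (hRpos B))).trans_lt hB
    rw [inv_div, sub_lt_comm, lt_div_iff₀ hWpos] at this
    linarith
  have hnonneg : ∀ B, 0 ≤ Real.log W.card - Real.log (R B).card := fun B =>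
    sub_nonneg.2 (Real.log_le_log (hRpos B) (mod_cast hle B))
  have h₁ : 3 * W.card < 4 * (R A).card := by
    exact_mod_cast hlarge A (by linarith [hnonneg (S \ A)])
  have h₂ : 3 * W.card < 4 * (R (S \ A)).card := by
    exact_mod_cast hlarge (S \ A) (by linarith [hnonneg A])
  have h₃ := Finset.card_union_add_card_inter (R A) (R (S \ A))
  have h₄ : (R A ∪ R (S \ A)).card ≤ W.card := Finset.card_le_card
    (Finset.union_subset (rainbowReach_subset W v _) (rainbowReach_subset W v _))
  obtain ⟨w, hw, hwv⟩ := Finset.exists_mem_ne (s := R A ∩ R (S \ A)) (by omega) v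
  rw [Finset.mem_inter] at hw
  obtain ⟨-, p, hp, hpA⟩ := mem_rainbowReach.1 hw.1
  obtain ⟨-, q, hq, hqA⟩ := mem_rainbowReach.1 hw.2
  exact exists_rainbow_cycle_of_walks hwv.symm hp hpA hq hqA

theorem card_cut_self_le (U W : Finset V) :
    (cut G W W).card ≤
      (cut G U U).card + (cut G (W \ U) (W \ U)).card + 2 * (cut G U (W \ U)).card := by
  have h : cut G W W ⊆
      (cut G U U ∪ cut G (W \ U) (W \ U)) ∪ (cut G U (W \ U) ∪ cut G (W \ U) U) := by
    intro e he
    simp only [Finset.mem_union, mem_cut, Finset.mem_sdiff] at he ⊢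
    tauto
  have h₁ := (Finset.card_le_card h).trans (Finset.card_union_le _ _)
  have h₂ := Finset.card_union_le (cut G U U) (cut G (W \ U) (W \ U))
  have h₃ := Finset.card_union_le (cut G U (W \ U)) (cut G (W \ U) U)
  rw [card_cut_comm (W \ U) U] at h₃
  omega

/-- Every graph contains a vertex set with logarithmic edge expansion. -/
theorem exists_expansion [Fintype V] (hV : 2 ≤ Fintype.card V) {K : ℝ}
    (hG : 2 * K * (Fintype.card V * Real.log (Fintype.card V)) ≤
      (cut G Finset.univ Finset.univ).card) :
    ∃ W : Finset V, 2 ≤ W.card ∧ ∀ U ⊆ W, U.Nonempty →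
      K * U.card * (Real.log W.card - Real.log U.card) ≤ (cut G U (W \ U)).card := by
  have hden : ∀ m : ℕ, 2 ≤ m → 0 < (m : ℝ) * Real.log m := by
    intro m hm
    have : (1 : ℝ) < m := by exact_mod_cast hm
    exact mul_pos (by linarith) (Real.log_pos this)
  obtain ⟨W, hW, hmax⟩ := Finset.exists_max_image
    ((Finset.univ : Finset (Finset V)).filter fun X => 2 ≤ X.card)
    (fun X => ((cut G X X).card : ℝ) / (X.card * Real.log X.card))
    ⟨Finset.univ, by simpa using hV⟩
  have hW2 : 2 ≤ W.card := (Finset.mem_filter.1 hW).2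
  set M : ℝ := ((cut G W W).card : ℝ) / (W.card * Real.log W.card) with hM
  have hM0 : 0 ≤ M := div_nonneg (Nat.cast_nonneg _) (hden _ hW2).le
  have hKM : 2 * K ≤ M := by
    refine le_trans ?_ (hmax Finset.univ (by simpa using hV))
    rw [Finset.card_univ, le_div_iff₀ (hden _ hV)]
    exact hG
  have hbound : ∀ X : Finset V, ((cut G X X).card : ℝ) ≤ M * (X.card * Real.log X.card) := by
    intro X
    rcases le_or_gt 2 X.card with hX | hX
    · rw [← div_le_iff₀ (hden _ hX)]
      exact hmax X (by simpa using hX)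
    · have : cut G X X = ∅ := by
        rw [Finset.eq_empty_iff_forall_notMem]
        intro e he
        obtain ⟨⟨h₁, h₂⟩, hadj⟩ := mem_cut.1 he
        exact hadj.ne (Finset.card_le_one.1 (by omega) _ h₁ _ h₂)
      rw [this, Finset.card_empty, Nat.cast_zero]
      have := Real.log_natCast_nonneg X.card
      positivity
  refine ⟨W, hW2, fun U hU hUne => ?_⟩
  have hUpos : (0 : ℝ) < U.card := by exact_mod_cast hUne.card_pos
  have hUW : (U.card : ℝ) ≤ W.card := by exact_mod_cast Finset.card_le_card hU
  have hlogUW := Real.log_le_log hUpos hUW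
  have hWM : ((cut G W W).card : ℝ) = M * (W.card * Real.log W.card) := by
    rw [hM, div_mul_cancel₀ _ (hden _ hW2).ne']
  have hsplit : ((cut G W W).card : ℝ) ≤
      (cut G U U).card + (cut G (W \ U) (W \ U)).card + 2 * (cut G U (W \ U)).card := by
    exact_mod_cast card_cut_self_le U W
  have hcompl : ((W \ U).card : ℝ) = W.card - U.card := by
    rw [Finset.card_sdiff_of_subset hU, Nat.cast_sub (Finset.card_le_card hU)]
  have hlogcompl : ((W \ U).card : ℝ) * Real.log (W \ U).card ≤
      (W.card - U.card) * Real.log W.card := by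
    rcases Nat.eq_zero_or_pos (W \ U).card with h | h
    · rw [← hcompl, h]
      simp
    · rw [← hcompl]
      refine mul_le_mul_of_nonneg_left (Real.log_le_log (by exact_mod_cast h) ?_) (Nat.cast_nonneg _)
      exact_mod_cast Finset.card_le_card Finset.sdiff_subset
  have h₁ := hbound U
  have h₂ := (hbound (W \ U)).trans (mul_le_mul_of_nonneg_left hlogcompl hM0)
  have h₃ : M * (U.card * (Real.log W.card - Real.log U.card)) ≤ 2 * (cut G U (W \ U)).card := by
    rw [hWM] at hsplit
    linarith
  have h₄ := mul_le_mul_of_nonneg_right hKM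
    (mul_nonneg hUpos.le (sub_nonneg.2 hlogUW))
  linarith

end RainbowReach

/-- There is a constant `C > 0` such that for all `n ≥ 3`, every properly
edge-colored graph on `n` vertices with at least `(C/2) n log n log log n` edges (i.e.,
average degree at least `C log n log log n`) contains a rainbow cycle. -/
theorem rainbow_cycle_theorem :
    ∃ C > (0 : ℝ), ∀ n : ℕ, 3 ≤ n →
      ∀ (G : SimpleGraph (Fin n)) (c : Sym2 (Fin n) → ℕ),
        (∀ a b b' : Fin n, G.Adj a b → G.Adj a b' → b ≠ b' → c s(a, b) ≠ c s(a, b')) →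
        (C / 2) * (n : ℝ) * Real.log n * Real.log (Real.log n) ≤ (G.edgeSet.ncard : ℝ) →
        ∃ (v : Fin n) (w : G.Walk v v), w.IsCycle ∧ (w.edges.map c).Nodup := by
  have hlog3 : 1 < Real.log 3 := by
    rw [Real.lt_log_iff_exp_lt (by norm_num)]
    linarith [Real.exp_one_lt_d9]
  set t₀ := Real.log (Real.log 3)
  have ht₀ : 0 < t₀ := Real.log_pos hlog3
  refine ⟨16 * (1 + 3 / t₀), by positivity, fun n hn G c hc hG => ?_⟩
  have hn' : (3 : ℝ) ≤ n := by exact_mod_cast hn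
  have hlogn : Real.log 3 ≤ Real.log n := Real.log_le_log (by norm_num) hn'
  have hlogpos : 0 < Real.log n := by linarith
  set t := Real.log (Real.log n) with ht
  have htt₀ : t₀ ≤ t := Real.log_le_log (by linarith) hlogn
  obtain ⟨W, hW, hK⟩ := exists_expansion (G := G) (K := 4 * (1 + 3 / t₀) * t)
    (by simpa using (by omega : 2 ≤ n)) (by
      rw [Fintype.card_fin]
      refine le_trans (le_of_eq ?_) (hG.trans (Nat.cast_le.2 ncard_edgeSet_le_card_cut))
      ring)
  refine exists_rainbow_cycle_of_expansion hc (S := Finset.univ.image c) (by simp) hW hK ?_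
  have hWn : Real.log W.card ≤ Real.log n := by
    refine Real.log_le_log (by exact_mod_cast (by omega : 0 < W.card)) ?_
    simpa using Finset.card_le_univ W
  have hexp : Real.exp (-3) < 1 / 8 := by
    have h1 : (2 : ℝ) < Real.exp 1 := by linarith [Real.exp_one_gt_d9]
    have h3 : (2 : ℝ) ^ 3 < Real.exp 1 ^ 3 := pow_lt_pow_left₀ h1 (by norm_num) (by norm_num)
    rw [← Real.exp_nat_mul] at h3
    rw [Real.exp_neg, one_div]
    refine inv_strictAnti₀ (by norm_num) ?_
    norm_num at h3
    exact h3
  calc Real.log W.card * Real.exp (-(4 * (1 + 3 / t₀) * t / 4))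
      ≤ Real.log n * Real.exp (-(4 * (1 + 3 / t₀) * t / 4)) :=
        mul_le_mul_of_nonneg_right hWn (Real.exp_pos _).le
    _ = Real.exp (-(3 * (t / t₀))) := by
        nth_rewrite 1 [← Real.exp_log hlogpos]
        rw [← ht, ← Real.exp_add]
        congr 1
        ring
    _ ≤ Real.exp (-3) := by
        have : 1 ≤ t / t₀ := (one_le_div ht₀).2 htt₀
        exact Real.exp_le_exp.2 (by linarith)
    _ < 1 / 8 := hexp
end
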